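/- arXiv:2112.07960 — 2 statements merged into one kernel-verified Lean document; each statement's English description precedes it below -/
import Mathlib

section
/- Under Assumption A(i) (the map a ↦ p(y|x,a) is continuous on A(x) for all x,y ∈ X), for each player i the set M_i of statewise projections onto K_i of occupation measures in M is a convex and compact subset of Pr(K_i) equipped with the weak topology. -/
open MeasureTheory ProbabilityTheory Filter Topology
open scoped ENNReal NNReal

namespace CSGame

/-- The joint action space of the players. -/
abbrev JA {n : ℕ} (A : Fin n → Type) : Type := (i : Fin n) → A i

/-- The data of a constrained discounted stochastic Markov game:
countable state space `X`, Borel action spaces `A i` with compact admissible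
action sets `As i x`, transition probability `p`, initial distribution `η`,
discount factor `α`, cost/constraint functions `c i ℓ` (`ℓ = 0` is the cost,
`ℓ ∈ L = {1,…,l}` are the constraints) and constraint bounds `κ i ℓ`. -/
structure GameData (n l : ℕ) (X : Type) (A : Fin n → Type)
    [MeasurableSpace X] [∀ i, MeasurableSpace (A i)] [∀ i, TopologicalSpace (A i)] where
  As : (i : Fin n) → X → Set (A i)
  p : X → JA A → Measure X
  η : Measure X
  α : ℝ
  c : Fin n → Fin (l + 1) → X → JA A → ℝ
  κ : Fin n → Fin (l + 1) → ℝ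
  hAs_ne : ∀ i x, (As i x).Nonempty
  hAs_cpt : ∀ i x, IsCompact (As i x)
  hp : ∀ x a, IsProbabilityMeasure (p x a)
  hpm : ∀ x y, Measurable fun a => p x a {y}
  hη : IsProbabilityMeasure η
  hα0 : 0 < α
  hα1 : α < 1
  hc : ∀ i ℓ x, Measurable (c i ℓ x)

variable {n l : ℕ}
variable {X : Type} [Countable X] [MeasurableSpace X] [DiscreteMeasurableSpace X]
  [TopologicalSpace X] [DiscreteTopology X] [BorelSpace X] [SecondCountableTopology X]
variable {A : Fin n → Type} [∀ i, MeasurableSpace (A i)] [∀ i, TopologicalSpace (A i)]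
  [∀ i, PolishSpace (A i)] [∀ i, BorelSpace (A i)]

/-- The set of feasible action profiles in state `x` (the section of `𝕂` at `x`). -/
def jointSet (G : GameData n l X A) (x : X) : Set (JA A) :=
  Set.univ.pi fun i => G.As i x

/-- Histories of the game: `Hist X AA t` records the initial state and `t`
state-action transitions, ending with the current state (this is `H^{t+1}`). -/
def Hist (X AA : Type) : ℕ → Type
  | 0 => X
  | t + 1 => Hist X AA t × AA × X

noncomputable instance histMS (X AA : Type) [MeasurableSpace X] [MeasurableSpace AA] :
    ∀ t, MeasurableSpace (Hist X AA t)
  | 0 => inferInstanceAs (MeasurableSpace X)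
  | t + 1 =>
      letI := histMS X AA t
      inferInstanceAs (MeasurableSpace (Hist X AA t × AA × X))

/-- The current (last) state of a history. -/
def lastState (X AA : Type) : ∀ t, Hist X AA t → X
  | 0, h => h
  | _ + 1, h => h.2.2

theorem measurable_lastState (X AA : Type) [MeasurableSpace X] [MeasurableSpace AA] :
    ∀ t, Measurable (lastState X AA t)
  | 0 => measurable_id
  | _ + 1 => measurable_snd.comp measurable_snd

variable (G : GameData n l X A)

/-- A (history dependent, randomised) strategy of player `i`: a sequence of
transition probabilities from histories to the action space of player `i`,
concentrated on the admissible action set at the current state. -/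
structure Strategy (i : Fin n) where
  f : ∀ t, Hist X (JA A) t → ProbabilityMeasure (A i)
  meas : ∀ t (s : Set (A i)), MeasurableSet s →
    Measurable fun h => (f t h : Measure (A i)) s
  supp : ∀ t h, f t h (G.As i (lastState X (JA A) t h)) = 1

/-- A stationary strategy of player `i`: a transition probability from states to
actions, concentrated on the admissible action set. -/
def Stat (i : Fin n) : Type :=
  {φ : X → ProbabilityMeasure (A i) // ∀ x, φ x (G.As i x) = 1}

noncomputable instance (i : Fin n) : TopologicalSpace (Stat G i) :=
  inferInstanceAs (TopologicalSpace
    {φ : X → ProbabilityMeasure (A i) // ∀ x, φ x (G.As i x) = 1})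

/-- Multi-strategies: one strategy for each player. -/
abbrev MultiStrategy : Type _ := ∀ i, Strategy G i

/-- Stationary multi-strategies (the set `Φ`). -/
abbrev StatProfile : Type _ := ∀ i, Stat G i

noncomputable instance : TopologicalSpace (StatProfile G) :=
  inferInstanceAs (TopologicalSpace (∀ i, Stat G i))

/-- The strategy induced by a stationary strategy. -/
noncomputable def ofStat (i : Fin n) (φ : Stat G i) : Strategy G i where
  f := fun t h => φ.1 (lastState X (JA A) t h)
  meas := fun t _s _hs =>
    (Measurable.of_discrete (f := fun x => (φ.1 x : Measure (A i)) _s)).comp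
      (measurable_lastState X (JA A) t)
  supp := fun t h => φ.2 _

/-- The multi-strategy induced by a stationary multi-strategy. -/
noncomputable def ofStatAll (φ : StatProfile G) : MultiStrategy G :=
  fun i => ofStat G i (φ i)

/-- `[π_{-i}, σ]` : player `i` deviates to `σ`, the others keep `π`. -/
noncomputable def combine (π : MultiStrategy G) (i : Fin n) (σ : Strategy G i) :
    MultiStrategy G :=
  Function.update π i σ

/-- `[φ_{-i}, γ]` for stationary profiles. -/
noncomputable def updStat (φ : StatProfile G) (i : Fin n) (γ : Stat G i) :
    StatProfile G :=
  Function.update φ i γ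

/-- The joint (product) distribution of the players' actions after history `h`. -/
noncomputable def jointLaw (π : MultiStrategy G) (t : ℕ) (h : Hist X (JA A) t) :
    Measure (JA A) :=
  Measure.pi fun i => ((π i).f t h : Measure (A i))

/-- The distribution of histories of length `t` under the multi-strategy `π`,
the transition probability `G.p` and the initial distribution `η'`
(the finite-dimensional marginals of the Ionescu–Tulcea measure `P^π_{η'}`). -/
noncomputable def histMeas (η' : Measure X) (π : MultiStrategy G) :
    ∀ t, Measure (Hist X (JA A) t)
  | 0 => η'
  | t + 1 =>
      (histMeas η' π t).bind fun h =>
        (jointLaw G π t h).bind fun a =>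
          (G.p (lastState X (JA A) t h) a).map fun y =>
            (show Hist X (JA A) (t + 1) from (h, a, y))

/-- Expected value of `f (x^{t+1}, a^{t+1})` under `π` (states enumerated from `1`
in the paper, from `0` here). -/
noncomputable def stageExp (η' : Measure X) (π : MultiStrategy G) (t : ℕ)
    (f : X → JA A → ℝ) : ℝ :=
  ∫ h, (∫ a, f (lastState X (JA A) t h) a ∂(jointLaw G π t h)) ∂(histMeas G η' π t)

/-- The expected discounted cost functional
`J(π) = (1-α) E^π_{η'} [∑_{t≥1} α^{t-1} f(x^t,a^t)]`. -/
noncomputable def Jfun (η' : Measure X) (f : X → JA A → ℝ) (π : MultiStrategy G) : ℝ :=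
  (1 - G.α) * ∑' t : ℕ, G.α ^ t * stageExp G η' π t f

/-- `J_i^ℓ(π)` of the paper. -/
noncomputable def J (i : Fin n) (ℓ : Fin (l + 1)) (π : MultiStrategy G) : ℝ :=
  Jfun G G.η (G.c i ℓ) π

/-- `π_i ∈ Δ_i(π_{-i})` : all constraints of player `i` are satisfied. -/
def Feas (i : Fin n) (π : MultiStrategy G) : Prop :=
  ∀ ℓ : Fin (l + 1), ℓ ≠ 0 → J G i ℓ π ≤ G.κ i ℓ

/-- Expectation of `w(x^{t+1})` (as an extended nonnegative real). -/
noncomputable def wStateExp (η' : Measure X) (π : MultiStrategy G) (t : ℕ)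
    (w : X → ℝ) : ℝ≥0∞ :=
  ∫⁻ h, ENNReal.ofReal (w (lastState X (JA A) t h)) ∂(histMeas G η' π t)

/-- Assumption A(i): continuity of the transition probability in the actions. -/
def AssumptionA1 : Prop :=
  ∀ x y, ContinuousOn (fun a => G.p x a {y}) (jointSet G x)

/-- Assumption A: continuity of the transition probability and of the
cost/constraint functions in the actions. -/
def AssumptionA : Prop :=
  AssumptionA1 G ∧ ∀ i ℓ x, ContinuousOn (G.c i ℓ x) (jointSet G x)

/-- Assumption B for the weight function `w`: `w ≥ 1` bounds all the costs on `𝕂`,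
the discounted tails `sup_π (1-α) E^π_η[∑_{t≥k} α^{t-1} w(x^t)]` vanish as `k → ∞`,
and for each stage `t` the family `{w(x^t)}` is uniformly integrable over all
multi-strategies. -/
def AssumptionB (w : X → ℝ) : Prop :=
  (∀ x, 1 ≤ w x) ∧
  (∀ i ℓ x a, a ∈ jointSet G x → |G.c i ℓ x a| ≤ w x) ∧
  Tendsto (fun k : ℕ => ⨆ π : MultiStrategy G,
      ENNReal.ofReal (1 - G.α) *
        ∑' t : ℕ, ENNReal.ofReal G.α ^ (k + t) * wStateExp G G.η π (k + t) w)
    atTop (𝓝 0) ∧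
  ∀ t : ℕ, Tendsto (fun k : ℕ => ⨆ π : MultiStrategy G,
      ∫⁻ h in {h | (k : ℝ) ≤ w (lastState X (JA A) t h)},
        ENNReal.ofReal (w (lastState X (JA A) t h)) ∂(histMeas G G.η π t))
    atTop (𝓝 0)

/-- Assumption C (Slater condition). -/
def AssumptionC : Prop :=
  ∀ (φ : StatProfile G) (i : Fin n), ∃ π : Strategy G i,
    ∀ ℓ : Fin (l + 1), ℓ ≠ 0 → J G i ℓ (combine G (ofStatAll G φ) i π) < G.κ i ℓ

/-- Assumption D: the initial distribution charges every state. -/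
def AssumptionD : Prop :=
  ∀ x : X, 0 < G.η {x}

/-- Assumption W (weighted-norm conditions of Wessels). -/
def AssumptionW (w : X → ℝ) : Prop :=
  (∀ x, 1 ≤ w x) ∧
  (∀ i ℓ x a, a ∈ jointSet G x → |G.c i ℓ x a| ≤ w x) ∧
  (∃ δ : ℝ, 1 ≤ δ ∧ δ * G.α < 1 ∧ ∀ x a, a ∈ jointSet G x →
      ∫⁻ y, ENNReal.ofReal (w y) ∂(G.p x a) ≤ ENNReal.ofReal (δ * w x)) ∧
  (∀ x, ContinuousOn (fun a => ∫⁻ y, ENNReal.ofReal (w y) ∂(G.p x a)) (jointSet G x)) ∧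
  (∫⁻ y, ENNReal.ofReal (w y) ∂G.η) < ⊤

/-- All cost and constraint functions are bounded. -/
def BoundedCosts : Prop :=
  ∀ i (ℓ : Fin (l + 1)), ∃ C : ℝ, ∀ x a, |G.c i ℓ x a| ≤ C

/-- A stationary multi-strategy `φ` is a Nash equilibrium of the constrained game:
it is feasible, and no player can lower his discounted cost by a unilateral
deviation to any (history dependent) strategy satisfying his constraints. -/
def IsNashStat (φ : StatProfile G) : Prop :=
  (∀ i, Feas G i (ofStatAll G φ)) ∧
  ∀ (i : Fin n) (σ : Strategy G i), Feas G i (combine G (ofStatAll G φ) i σ) →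
    J G i 0 (ofStatAll G φ) ≤ J G i 0 (combine G (ofStatAll G φ) i σ)

section Occupation

/-- A correlated strategy of the players. -/
structure CorrStrategy where
  f : ∀ t, Hist X (JA A) t → ProbabilityMeasure (JA A)
  meas : ∀ t (s : Set (JA A)), MeasurableSet s →
    Measurable fun h => (f t h : Measure (JA A)) s
  supp : ∀ t h, f t h (jointSet G (lastState X (JA A) t h)) = 1

/-- History distributions under a correlated strategy. -/
noncomputable def histMeasC (π : CorrStrategy G) : ∀ t, Measure (Hist X (JA A) t)
  | 0 => G.η
  | t + 1 =>
      (histMeasC π t).bind fun h =>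
        ((π.f t h : Measure (JA A))).bind fun a =>
          (G.p (lastState X (JA A) t h) a).map fun y =>
            (show Hist X (JA A) (t + 1) from (h, a, y))

/-- The occupation measure `ρ(K') = (1-α) E^π_η [∑_{t≥1} α^{t-1} 1_{K'}(x^t,a^t)]`
of a correlated strategy, as a measure on the state–action pairs. -/
noncomputable def occ (π : CorrStrategy G) : Measure (X × JA A) :=
  ENNReal.ofReal (1 - G.α) •
    Measure.sum fun t : ℕ => ENNReal.ofReal G.α ^ t •
      ((histMeasC G π t).bind fun h =>
        (π.f t h : Measure (JA A)).map fun a => (lastState X (JA A) t h, a))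

/-- The set `𝓜` of occupation measures of correlated strategies. -/
def OccSet : Set (ProbabilityMeasure (X × JA A)) :=
  {ρ | ∃ π : CorrStrategy G, (ρ : Measure (X × JA A)) = occ G π}

/-- Projection of a state–action pair onto the coordinates of player `i`. -/
def projAct (i : Fin n) : X × JA A → X × A i := fun q => (q.1, q.2 i)

/-- The set `𝓜_i` of statewise projections of occupation measures onto `𝕂_i`. -/
def MiSet (i : Fin n) : Set (ProbabilityMeasure (X × A i)) :=
  {μ | ∃ ρ ∈ OccSet G, (μ : Measure (X × A i)) = (ρ : Measure (X × JA A)).map (projAct i)}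

/-- The marginal `μ̂(x) = μ({x} × A_i(x))`. -/
noncomputable def marg (i : Fin n) (μ : ProbabilityMeasure (X × A i)) (x : X) : ℝ≥0∞ :=
  (μ : Measure (X × A i)) ({x} ×ˢ G.As i x)

/-- `μ = μ̂ φ` : `φ` disintegrates `μ`, i.e. `μ({x} × B) = φ(B|x) μ̂(x)`. -/
def Disint (i : Fin n) (μ : ProbabilityMeasure (X × A i)) (φ : Stat G i) : Prop :=
  ∀ x (B : Set (A i)), MeasurableSet B → B ⊆ G.As i x →
    (μ : Measure (X × A i)) ({x} ×ˢ B) = (φ.1 x B : ℝ≥0∞) * marg G i μ x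

/-- The occupation measure on state–action pairs of a multi-strategy. -/
noncomputable def occMulti (η' : Measure X) (π : MultiStrategy G) : Measure (X × JA A) :=
  ENNReal.ofReal (1 - G.α) •
    Measure.sum fun t : ℕ => ENNReal.ofReal G.α ^ t •
      ((histMeas G η' π t).bind fun h =>
        (jointLaw G π t h).map fun a => (lastState X (JA A) t h, a))

end Occupation

section COP

/-- The product distribution on action profiles in state `x` in which player `i`
plays the fixed action `ai` and every player `j ≠ i` plays `φ j`. -/
noncomputable def statJoint (φ : StatProfile G) (i : Fin n) (x : X) (ai : A i) :
    Measure (JA A) :=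
  Measure.pi fun j =>
    if h : j = i then Measure.dirac (cast (congrArg A h.symm) ai)
    else ((φ j).1 x : Measure (A j))

/-- `c_i^ℓ(x, [φ_{-i}(x), a_i])`. -/
noncomputable def cbar (φ : StatProfile G) (i : Fin n) (ℓ : Fin (l + 1)) (x : X)
    (ai : A i) : ℝ :=
  ∫ a, G.c i ℓ x a ∂(statJoint G φ i x ai)

/-- `p(y | x, [φ_{-i}(x), a_i])`. -/
noncomputable def pbar (φ : StatProfile G) (i : Fin n) (y x : X) (ai : A i) : ℝ≥0∞ :=
  ∫⁻ a, G.p x a {y} ∂(statJoint G φ i x ai)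

/-- Feasibility in the constrained optimisation problem `COP(φ_{-i})`:
`μ ∈ Pr(𝕂_i)` satisfies the constraint inequalities and the characteristic
equations of occupation measures. -/
def COPFeasible (φ : StatProfile G) (i : Fin n)
    (μ : ProbabilityMeasure (X × A i)) : Prop :=
  (μ : Measure (X × A i)) {q : X × A i | q.2 ∈ G.As i q.1} = 1 ∧
  (∀ ℓ : Fin (l + 1), ℓ ≠ 0 →
    ∫ q : X × A i, cbar G φ i ℓ q.1 q.2 ∂(μ : Measure (X × A i)) ≤ G.κ i ℓ) ∧
  ∀ x : X, (μ : Measure (X × A i)) ({x} ×ˢ G.As i x) =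
    ENNReal.ofReal (1 - G.α) * G.η {x} +
      ENNReal.ofReal G.α *
        ∫⁻ q : X × A i, pbar G φ i x q.1 q.2 ∂(μ : Measure (X × A i))

/-- The objective of `COP(φ_{-i})`. -/
noncomputable def COPObj (φ : StatProfile G) (i : Fin n)
    (μ : ProbabilityMeasure (X × A i)) : ℝ :=
  ∫ q : X × A i, cbar G φ i 0 q.1 q.2 ∂(μ : Measure (X × A i))

/-- The solution set `𝓞_i(φ_{-i})` of `COP(φ_{-i})`. -/
def COPSol (φ : StatProfile G) (i : Fin n) : Set (ProbabilityMeasure (X × A i)) :=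
  {μ | COPFeasible G φ i μ ∧
    ∀ ν, COPFeasible G φ i ν → COPObj G φ i μ ≤ COPObj G φ i ν}

end COP

section Perturbed

/-- `η̃` is a probability measure charging exactly the `η`-null states `X_0`. -/
def IsPerturb (ηt : Measure X) : Prop :=
  IsProbabilityMeasure ηt ∧ (∀ x, G.η {x} = 0 → 0 < ηt {x}) ∧
    ∀ x, G.η {x} ≠ 0 → ηt {x} = 0

/-- The perturbed initial distribution `η(m) = (1 - 1/m) η + (1/m) η̃`. -/
noncomputable def etam (ηt : Measure X) (m : ℕ) : Measure X :=
  ENNReal.ofReal (1 - 1 / (m : ℝ)) • G.η + ENNReal.ofReal (1 / (m : ℝ)) • ηt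

/-- The truncation `c_i^{ℓ,m}` of `c_i^ℓ` at the level `√m`. -/
noncomputable def ctrunc (i : Fin n) (ℓ : Fin (l + 1)) (m : ℕ) (x : X) (a : JA A) : ℝ :=
  max (-Real.sqrt m) (min (G.c i ℓ x a) (Real.sqrt m))

/-- `J_i^{ℓ,η(m)}`: discounted cost with truncated costs and perturbed initial
distribution. -/
noncomputable def Jm (ηt : Measure X) (m : ℕ) (i : Fin n) (ℓ : Fin (l + 1))
    (π : MultiStrategy G) : ℝ :=
  Jfun G (etam G ηt m) (ctrunc G i ℓ m) π

/-- The perturbed constraint bounds `κ_i^{ℓ,m} = (1 - 1/m) κ_i^ℓ + 1/√m`. -/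
noncomputable def kappam (i : Fin n) (ℓ : Fin (l + 1)) (m : ℕ) : ℝ :=
  (1 - 1 / (m : ℝ)) * G.κ i ℓ + 1 / Real.sqrt m

/-- `π_i ∈ Δ_i^m(π_{-i})` : the constraints of the `m`-CSG hold. -/
def FeasM (ηt : Measure X) (m : ℕ) (i : Fin n) (π : MultiStrategy G) : Prop :=
  ∀ ℓ : Fin (l + 1), ℓ ≠ 0 → Jm G ηt m i ℓ π ≤ kappam G i ℓ m

end Perturbed

end CSGame

open CSGame

namespace CSGame

variable {n l : ℕ}
variable {X : Type} [Countable X] [MeasurableSpace X] [DiscreteMeasurableSpace X]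
  [TopologicalSpace X] [DiscreteTopology X] [BorelSpace X] [SecondCountableTopology X]
variable {A : Fin n → Type} [∀ i, MeasurableSpace (A i)] [∀ i, TopologicalSpace (A i)]
  [∀ i, PolishSpace (A i)] [∀ i, BorelSpace (A i)]
variable (G : GameData n l X A)

set_option linter.unusedSectionVars false

/-- The graph of the admissible action profiles. -/
def KSet : Set (X × JA A) := {q | q.2 ∈ jointSet G q.1}

/-- The balance characterisation of occupation measures. -/
def Bal (ρ : Measure (X × JA A)) : Prop :=
  ρ (KSet G)ᶜ = 0 ∧ ∀ y, ρ (Prod.fst ⁻¹' {y}) =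
    ENNReal.ofReal (1 - G.α) * G.η {y} + ENNReal.ofReal G.α * ∫⁻ q, G.p q.1 q.2 {y} ∂ρ

theorem isCompact_jointSet (x : X) : IsCompact (jointSet G x) :=
  isCompact_univ_pi fun i => G.hAs_cpt i x

theorem isClosed_KSet : IsClosed (KSet G) := by
  rw [← isOpen_compl_iff, isOpen_prod_iff]
  intro x a h
  refine ⟨{x}, (jointSet G x)ᶜ, isOpen_discrete _, (isCompact_jointSet G x).isClosed.isOpen_compl,
    rfl, h, ?_⟩
  rintro ⟨x', a'⟩ ⟨h1, h2⟩
  obtain rfl : x' = x := h1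
  exact h2

/-- The transition kernel. -/
noncomputable def pKer : Kernel (X × JA A) X where
  toFun q := G.p q.1 q.2
  measurable' := by
    refine Measure.measurable_of_measurable_coe _ fun s hs => ?_
    refine measurable_from_prod_countable_right fun x => ?_
    have : ∀ a, G.p x a s = ∑' y : s, G.p x a {(y : X)} := fun a => by
      rw [← measure_biUnion (Set.to_countable s)]
      · simp
      · intro a _ b _ hab
        simpa [Function.onFun] using hab
      · intro _ _
        exact MeasurableSet.of_discrete
    simp only [this]
    exact Measurable.tsum fun y => G.hpm x y

instance : IsMarkovKernel (pKer G) := ⟨fun q => G.hp q.1 q.2⟩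

/-- The kernel of a correlated strategy at stage `t`. -/
noncomputable def polKer (π : CorrStrategy G) (t : ℕ) : Kernel (Hist X (JA A) t) (JA A) where
  toFun h := π.f t h
  measurable' := Measure.measurable_of_measurable_coe _ fun s hs => π.meas t s hs

instance (π : CorrStrategy G) (t : ℕ) : IsMarkovKernel (polKer G π t) :=
  ⟨fun h => inferInstanceAs (IsProbabilityMeasure (π.f t h : Measure (JA A)))⟩

/-- Law of the state-action pair at stage `t`. -/
noncomputable def stage (π : CorrStrategy G) (t : ℕ) : Measure (X × JA A) :=
  (histMeasC G π t).bind fun h =>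
        (π.f t h : Measure (JA A)).map fun a => (lastState X (JA A) t h, a)

theorem lintegral_stage (π : CorrStrategy G) (t : ℕ) (g : X × JA A → ℝ≥0∞) (hg : Measurable g) :
    ∫⁻ q, g q ∂(stage G π t) =
      ∫⁻ h, ∫⁻ a, g (lastState X (JA A) t h, a) ∂(π.f t h : Measure (JA A)) ∂(histMeasC G π t) := by
  have hl := measurable_lastState X (JA A) t
  rw [stage, Measure.lintegral_bind _ hg.aemeasurable]
  · refine lintegral_congr fun h => ?_
    rw [lintegral_map hg (by fun_prop)]
  · refine Measurable.aemeasurable ?_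
    refine Measure.measurable_of_measurable_coe _ fun s hs => ?_
    have hm : MeasurableSet ((fun z : Hist X (JA A) t × JA A =>
        (lastState X (JA A) t z.1, z.2)) ⁻¹' s) := by
      refine measurableSet_preimage ?_ hs
      fun_prop
    convert Kernel.measurable_kernel_prodMk_left (κ := polKer G π t) hm using 1
    ext h
    rw [Measure.map_apply (by fun_prop) hs]
    rfl

theorem lintegral_hist_succ (π : CorrStrategy G) (t : ℕ) (f : X → ℝ≥0∞) :
    ∫⁻ h, f (lastState X (JA A) (t + 1) h) ∂(histMeasC G π (t + 1)) =
      ∫⁻ q, ∫⁻ y, f y ∂(G.p q.1 q.2) ∂(stage G π t) := by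
  have hl := measurable_lastState X (JA A) t
  have hl' := measurable_lastState X (JA A) (t + 1)
  have hf : Measurable f := .of_discrete
  have hmk : Measurable (fun z : (Hist X (JA A) t × JA A) × X =>
      (show Hist X (JA A) (t + 1) from (z.1.1, z.1.2, z.2))) := by
    change Measurable (fun z : (Hist X (JA A) t × JA A) × X => (z.1.1, z.1.2, z.2))
    fun_prop
  -- the kernel (h, a) ↦ law of (h, a, y)
  let T : Kernel (Hist X (JA A) t × JA A) X :=
    (pKer G).comap (fun z => (lastState X (JA A) t z.1, z.2)) (by fun_prop)
  have hT : Measurable (fun z : Hist X (JA A) t × JA A =>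
      (G.p (lastState X (JA A) t z.1) z.2).map fun y =>
            (show Hist X (JA A) (t + 1) from (z.1, z.2, y))) := by
    refine Measure.measurable_of_measurable_coe _ fun s hs => ?_
    convert Kernel.measurable_kernel_prodMk_left (κ := T) (hmk hs) using 1
    ext z
    rw [Measure.map_apply (by fun_prop) hs]
    rfl
  have hB : Measurable (fun h : Hist X (JA A) t =>
        ((π.f t h : Measure (JA A))).bind fun a =>
          (G.p (lastState X (JA A) t h) a).map fun y =>
            (show Hist X (JA A) (t + 1) from (h, a, y))) := by
    refine Measure.measurable_of_measurable_coe _ fun s hs => ?_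
    have := Measurable.lintegral_kernel_prod_right (κ := polKer G π t)
      (f := fun h a => ((G.p (lastState X (JA A) t h) a).map fun y =>
            (show Hist X (JA A) (t + 1) from (h, a, y))) s)
      ((Measure.measurable_coe hs).comp hT)
    convert this using 1
    ext h
    exact Measure.bind_apply hs (hT.comp measurable_prodMk_left).aemeasurable
  rw [lintegral_stage]
  · change ∫⁻ h, f (lastState X (JA A) (t + 1) h) ∂((histMeasC G π t).bind fun h =>
        ((π.f t h : Measure (JA A))).bind fun a =>
          (G.p (lastState X (JA A) t h) a).map fun y =>
            (show Hist X (JA A) (t + 1) from (h, a, y))) = _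
    have hfl : Measurable (fun h => f (lastState X (JA A) (t + 1) h)) := hf.comp hl'
    refine (Measure.lintegral_bind hB.aemeasurable hfl.aemeasurable).trans ?_
    refine lintegral_congr fun h => ?_
    refine (Measure.lintegral_bind (hT.comp measurable_prodMk_left).aemeasurable
      hfl.aemeasurable).trans ?_
    refine lintegral_congr fun a => ?_
    refine (lintegral_map hfl (hmk.comp measurable_prodMk_left)).trans ?_
    rfl
  · exact Measurable.lintegral_kernel (κ := pKer G) hf

theorem lintegral_occ (π : CorrStrategy G) (g : X × JA A → ℝ≥0∞) :
    ∫⁻ q, g q ∂(occ G π) = ENNReal.ofReal (1 - G.α) *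
      ∑' t : ℕ, ENNReal.ofReal G.α ^ t * ∫⁻ q, g q ∂(stage G π t) := by
  rw [occ, lintegral_smul_measure, lintegral_sum_measure]
  simp only [lintegral_smul_measure, smul_eq_mul]
  rfl

theorem lintegral_stage_fst (π : CorrStrategy G) (t : ℕ) (f : X → ℝ≥0∞) :
    ∫⁻ q, f q.1 ∂(stage G π t) = ∫⁻ h, f (lastState X (JA A) t h) ∂(histMeasC G π t) := by
  have hf : Measurable (fun q : X × JA A => f q.1) :=
    (Measurable.of_discrete (f := f)).comp measurable_fst
  rw [lintegral_stage _ _ _ _ hf]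
  simp

theorem stage_KSet (π : CorrStrategy G) (t : ℕ) : stage G π t (KSet G)ᶜ = 0 := by
  have hm := (isClosed_KSet G).measurableSet.compl
  rw [← lintegral_indicator_one hm, lintegral_stage _ _ _ _ (measurable_one.indicator hm)]
  have : ∀ h, ∫⁻ a, (KSet G)ᶜ.indicator 1 (lastState X (JA A) t h, a)
      ∂(π.f t h : Measure (JA A)) = 0 := by
    intro h
    have hs := π.supp t h
    have hj := (isCompact_jointSet G (lastState X (JA A) t h)).isClosed.measurableSet
    have e : (fun a => (KSet G)ᶜ.indicator (1 : X × JA A → ℝ≥0∞) (lastState X (JA A) t h, a)) =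
      (jointSet G (lastState X (JA A) t h))ᶜ.indicator 1 := by
      ext a; by_cases ha : a ∈ jointSet G (lastState X (JA A) t h) <;> simp [KSet, ha]
    rw [e, lintegral_indicator_one hj.compl, prob_compl_eq_zero_iff hj]
    rw [← ProbabilityMeasure.ennreal_coeFn_eq_coeFn_toMeasure, hs]; rfl
  simp [this]

theorem lintegral_fst_indicator (ρ : Measure (X × JA A)) (y : X) :
    ρ (Prod.fst ⁻¹' {y}) = ∫⁻ q, ({y} : Set X).indicator 1 q.1 ∂ρ := by
  have : MeasurableSet (Prod.fst ⁻¹' {y} : Set (X × JA A)) :=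
    measurable_fst (MeasurableSet.of_discrete)
  rw [← lintegral_indicator_one this]
  rfl

theorem bal_of_occ (π : CorrStrategy G) : Bal G (occ G π) := by
  constructor
  · have hm := (isClosed_KSet G).measurableSet.compl
    rw [← lintegral_indicator_one hm, lintegral_occ]
    simp [lintegral_indicator_one hm, stage_KSet]
  · intro y
    rw [lintegral_fst_indicator, lintegral_occ, lintegral_occ, tsum_eq_zero_add' ENNReal.summable]
    have h0 : ∫⁻ q, ({y} : Set X).indicator 1 q.1 ∂(stage G π 0) = G.η {y} := by
      rw [lintegral_stage_fst]
      exact lintegral_indicator_one (μ := G.η) (MeasurableSet.of_discrete)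
    have h1 : ∀ t, ∫⁻ q, ({y} : Set X).indicator 1 q.1 ∂(stage G π (t + 1)) =
        ∫⁻ q, G.p q.1 q.2 {y} ∂(stage G π t) := fun t => by
      rw [lintegral_stage_fst, lintegral_hist_succ]
      simp
    simp only [h0, h1, pow_zero, one_mul, mul_add, pow_succ']
    congr 1
    simp only [mul_assoc, ENNReal.tsum_mul_left]
    ring

theorem histMeasC_univ (π : CorrStrategy G) (t : ℕ) : histMeasC G π t Set.univ = 1 := by
  have := G.hη
  have := G.hp
  induction t with
  | zero => exact measure_univ (μ := G.η)
  | succ t ih =>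
    have h := lintegral_hist_succ G π t (fun _ => 1)
    have h2 := lintegral_stage G π t (fun _ => 1) measurable_const
    simp only [lintegral_const, one_mul, measure_univ] at h h2
    rw [h, h2, ih]

theorem occ_univ (π : CorrStrategy G) : occ G π Set.univ = 1 := by
  have h := lintegral_occ G π (fun _ => 1)
  have h2 : ∀ t, stage G π t Set.univ = 1 := fun t => by
    have h2 := lintegral_stage G π t (fun _ => 1) measurable_const
    simpa [histMeasC_univ] using h2
  simp only [lintegral_const, one_mul, h2, mul_one, ENNReal.tsum_geometric] at h
  have hα1 := G.hα1
  have hα0 := G.hα0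
  rw [h, ENNReal.ofReal_sub _ hα0.le, ENNReal.ofReal_one]
  refine ENNReal.mul_inv_cancel ?_ ?_
  · simpa [tsub_eq_zero_iff_le] using hα1
  · exact ENNReal.sub_ne_top ENNReal.one_ne_top
theorem bal_lintegral (ρ : Measure (X × JA A)) (h : Bal G ρ) (k : X → ℝ≥0∞) :
    ∫⁻ q, k q.1 ∂ρ = ENNReal.ofReal (1 - G.α) * ∫⁻ x, k x ∂G.η +
      ENNReal.ofReal G.α * ∫⁻ q, ∫⁻ y, k y ∂(G.p q.1 q.2) ∂ρ := by
  have hk : Measurable k := .of_discrete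
  have e : ρ.map Prod.fst = ENNReal.ofReal (1 - G.α) • G.η +
      ENNReal.ofReal G.α • ρ.bind (pKer G) := by
    rw [Measure.ext_iff_singleton]
    intro y
    rw [Measure.map_apply measurable_fst (MeasurableSet.of_discrete), h.2 y]
    simp only [Measure.add_apply, Measure.smul_apply, smul_eq_mul]
    rw [Measure.bind_apply (MeasurableSet.of_discrete) (pKer G).aemeasurable]
    rfl
  rw [← lintegral_map hk measurable_fst, e, lintegral_add_measure, lintegral_smul_measure,
    lintegral_smul_measure, Measure.lintegral_bind (pKer G).aemeasurable hk.aemeasurable]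
  rfl

/-- Correlated stationary strategy. -/
noncomputable def ofKer (κ : X → ProbabilityMeasure (JA A)) (hκ : ∀ x, κ x (jointSet G x) = 1) :
    CorrStrategy G where
  f t h := κ (lastState X (JA A) t h)
  meas t s hs := (Measurable.of_discrete (f := fun x => (κ x : Measure (JA A)) s)).comp
      (measurable_lastState X (JA A) t)
  supp t h := hκ _

theorem partial_le (ρ : Measure (X × JA A)) (h : Bal G ρ) (κ : X → ProbabilityMeasure (JA A))
    (hκ : ∀ x, κ x (jointSet G x) = 1)
    (hd : ∀ g : X × JA A → ℝ≥0∞, Measurable g →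
      ∫⁻ q, ∫⁻ a, g (q.1, a) ∂(κ q.1 : Measure (JA A)) ∂ρ = ∫⁻ q, g q ∂ρ) (T : ℕ) :
    ∀ g : X × JA A → ℝ≥0∞, Measurable g →
    ∑ t ∈ Finset.range T, ENNReal.ofReal (1 - G.α) * (ENNReal.ofReal G.α ^ t *
      ∫⁻ q, g q ∂(stage G (ofKer G κ hκ) t)) ≤ ∫⁻ q, g q ∂ρ := by
  induction T with
  | zero => intro g _; simp
  | succ T ih =>
    intro g hg
    set k : X → ℝ≥0∞ := fun x => ∫⁻ a, g (x, a) ∂(κ x : Measure (JA A)) with hk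
    have hst : ∀ t, ∫⁻ q, g q ∂(stage G (ofKer G κ hκ) t) =
        ∫⁻ h, k (lastState X (JA A) t h) ∂(histMeasC G (ofKer G κ hκ) t) := fun t =>
      lintegral_stage _ _ _ _ hg
    have hg' : Measurable fun q : X × JA A => ∫⁻ y, k y ∂(G.p q.1 q.2) :=
      Measurable.lintegral_kernel (κ := pKer G) (.of_discrete)
    have h1 := ih _ hg'
    rw [Finset.sum_range_succ', ← hd g hg]
    change _ ≤ ∫⁻ q, k q.1 ∂ρ
    rw [bal_lintegral G ρ h k, add_comm]
    refine add_le_add ?_ ?_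
    · rw [hst]
      simp only [pow_zero, one_mul]
      exact le_rfl
    · refine le_trans (le_of_eq ?_) (mul_le_mul_right h1 _)
      rw [Finset.mul_sum]
      refine Finset.sum_congr rfl fun t _ => ?_
      rw [hst, lintegral_hist_succ, pow_succ]
      ring

theorem occ_of_bal (ρ : Measure (X × JA A)) [IsProbabilityMeasure ρ] (h : Bal G ρ) :
    ∃ π : CorrStrategy G, ρ = occ G π := by
  have hX : Nonempty X := by
    have := G.hη
    exact nonempty_of_isProbabilityMeasure G.η
  have hne : ∀ x, (jointSet G x).Nonempty := fun x => Set.univ_pi_nonempty_iff.2 fun i => G.hAs_ne i x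
  choose a₀ ha₀ using hne
  have : Nonempty (JA A) := ⟨a₀ hX.some⟩
  have hj : ∀ x, MeasurableSet (jointSet G x) := fun x =>
    (isCompact_jointSet G x).isClosed.measurableSet
  have hm := (isClosed_KSet G).measurableSet.compl
  classical
  let κ : X → ProbabilityMeasure (JA A) := fun x =>
    if ρ.condKernel x (jointSet G x) = 1 then ⟨ρ.condKernel x, inferInstance⟩
    else ⟨Measure.dirac (a₀ x), inferInstance⟩
  have hκ : ∀ x, κ x (jointSet G x) = 1 := by
    intro x
    rw [← ENNReal.coe_inj, ProbabilityMeasure.ennreal_coeFn_eq_coeFn_toMeasure]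
    by_cases hx : ρ.condKernel x (jointSet G x) = 1
    · simp [κ, hx]
    · simp only [κ, hx, if_false]
      simp [Measure.dirac_apply' _ (hj x), ha₀ x]
  have hae : ∀ᵐ x ∂ρ.fst, (κ x : Measure (JA A)) = ρ.condKernel x := by
    have h0 := Measure.lintegral_condKernel (ρ := ρ) (f := (KSet G)ᶜ.indicator 1)
      (measurable_one.indicator hm)
    rw [lintegral_indicator_one hm, h.1, lintegral_eq_zero_iff .of_discrete] at h0
    filter_upwards [h0] with x hx
    have e : (fun a => (KSet G)ᶜ.indicator (1 : X × JA A → ℝ≥0∞) (x, a)) =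
      (jointSet G x)ᶜ.indicator 1 := by
      ext a; by_cases ha : a ∈ jointSet G x <;> simp [KSet, ha]
    rw [e, lintegral_indicator_one (hj x).compl] at hx
    have hx' : ρ.condKernel x (jointSet G x) = 1 := (prob_compl_eq_zero_iff (hj x)).1 hx
    simp [κ, hx']
  have hd : ∀ g : X × JA A → ℝ≥0∞, Measurable g →
      ∫⁻ q, ∫⁻ a, g (q.1, a) ∂(κ q.1 : Measure (JA A)) ∂ρ = ∫⁻ q, g q ∂ρ := by
    intro g hg
    rw [← Measure.lintegral_condKernel hg]
    have := lintegral_map (μ := ρ) (f := fun x => ∫⁻ a, g (x, a) ∂(κ x : Measure (JA A)))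
      (g := Prod.fst) .of_discrete measurable_fst
    rw [← this]
    refine lintegral_congr_ae ?_
    filter_upwards [hae] with x hx
    rw [hx]
  refine ⟨ofKer G κ hκ, ?_⟩
  have hle : occ G (ofKer G κ hκ) ≤ ρ := by
    refine Measure.le_iff.2 fun s hs => ?_
    rw [← lintegral_indicator_one hs, ← lintegral_indicator_one hs, lintegral_occ,
      ← ENNReal.tsum_mul_left]
    refine ENNReal.tsum_le_of_sum_range_le fun T => ?_
    exact partial_le G ρ h κ hκ hd T _ (measurable_one.indicator hs)
  have : IsProbabilityMeasure (occ G (ofKer G κ hκ)) := ⟨occ_univ _ _⟩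
  ext s hs
  refine le_antisymm ?_ (hle s)
  have h1 := hle sᶜ
  rw [prob_compl_eq_one_sub hs, prob_compl_eq_one_sub hs] at h1
  exact (ENNReal.sub_le_sub_iff_left prob_le_one ENNReal.one_ne_top).1 h1

theorem mem_OccSet (ρ : ProbabilityMeasure (X × JA A)) : ρ ∈ OccSet G ↔ Bal G ρ := by
  constructor
  · rintro ⟨π, hπ⟩
    rw [hπ]
    exact bal_of_occ G π
  · exact occ_of_bal G ρ
theorem exists_finset_sum (μ : Measure X) [IsProbabilityMeasure μ] {ε : ℝ≥0∞} (hε : 0 < ε) :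
    ∃ F : Finset X, 1 - ε < ∑ y ∈ F, μ {y} := by
  have h : ∑' y, μ {y} = 1 := by
    have h0 := lintegral_countable' (μ := μ) (fun _ => 1)
    simpa using h0.symm
  have h1 : 1 - ε < ∑' y, μ {y} := by
    rw [h]
    exact ENNReal.sub_lt_self ENNReal.one_ne_top one_ne_zero hε.ne'
  rw [ENNReal.tsum_eq_iSup_sum] at h1
  exact lt_iSup_iff.1 h1

theorem compl_le_of_sum (μ : Measure X) [IsProbabilityMeasure μ] {ε : ℝ≥0∞}
    {F : Finset X} (h : 1 - ε < ∑ y ∈ F, μ {y}) : μ (F : Set X)ᶜ ≤ ε := by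
  rw [sum_measure_singleton] at h
  rw [prob_compl_eq_one_sub F.measurableSet]
  rw [tsub_le_iff_right, add_comm, ← tsub_le_iff_right]
  exact h.le

theorem exists_finset_p (hA1 : AssumptionA1 G) (x : X) {ε : ℝ≥0∞} (hε : 0 < ε) :
    ∃ F : Finset X, ∀ a ∈ jointSet G x, G.p x a (F : Set X)ᶜ ≤ ε := by
  classical
  have := G.hp
  refine (isCompact_jointSet G x).induction_on
    (p := fun s => ∃ F : Finset X, ∀ a ∈ s, G.p x a (F : Set X)ᶜ ≤ ε) ⟨∅, by simp⟩ ?_ ?_ ?_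
  · rintro s t hst ⟨F, hF⟩
    exact ⟨F, fun a ha => hF a (hst ha)⟩
  · rintro s t ⟨F, hF⟩ ⟨F', hF'⟩
    refine ⟨F ∪ F', ?_⟩
    rintro a (ha | ha)
    · exact (measure_mono (by simp [Set.compl_subset_compl])).trans (hF a ha)
    · exact (measure_mono (by simp [Set.compl_subset_compl])).trans (hF' a ha)
  · intro a ha
    obtain ⟨F, hF⟩ := exists_finset_sum (G.p x a) hε
    have hc : ContinuousOn (fun b => ∑ y ∈ F, G.p x b {y}) (jointSet G x) :=
      continuousOn_finsetSum F fun y _ => hA1 x y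
    refine ⟨_, (hc a ha).eventually (lt_mem_nhds hF), F, fun b hb => ?_⟩
    exact compl_le_of_sum _ hb

theorem bal_ae (ρ : Measure (X × JA A)) (h : Bal G ρ) : ∀ᵐ q ∂ρ, q.2 ∈ jointSet G q.1 := h.1

theorem bal_set (ρ : Measure (X × JA A)) (h : Bal G ρ) (B : Set X) :
    ρ (Prod.fst ⁻¹' B) = ENNReal.ofReal (1 - G.α) * G.η B +
      ENNReal.ofReal G.α * ∫⁻ q, G.p q.1 q.2 B ∂ρ := by
  have hB : MeasurableSet B := .of_discrete
  have := bal_lintegral G ρ h (B.indicator 1)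
  simp only [lintegral_indicator_one hB] at this
  rw [← this, ← lintegral_indicator_one (measurable_fst hB)]
  rfl

theorem tight_step (hA1 : AssumptionA1 G) (F : Finset X) {ε : ℝ≥0∞} (hε : 0 < ε) :
    ∃ F' : Finset X, ∀ ρ : ProbabilityMeasure (X × JA A), Bal G ρ →
      (ρ : Measure (X × JA A)) (Prod.fst ⁻¹' (F' : Set X)ᶜ) ≤
        ENNReal.ofReal G.α * (ρ : Measure (X × JA A)) (Prod.fst ⁻¹' (F : Set X)ᶜ) + ε := by
  classical
  have := G.hη
  have := G.hp
  obtain ⟨F₀, hF₀⟩ := exists_finset_sum G.η hε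
  choose F₁ hF₁ using fun x => exists_finset_p G hA1 x hε
  refine ⟨F₀ ∪ F.biUnion F₁, fun ρ hρ => ?_⟩
  rw [bal_set G ρ hρ]
  have h1 : G.η ((F₀ ∪ F.biUnion F₁ : Finset X) : Set X)ᶜ ≤ ε := by
    refine (measure_mono ?_).trans (compl_le_of_sum _ hF₀)
    rw [Set.compl_subset_compl, Finset.coe_subset]
    exact Finset.subset_union_left
  have hmF : MeasurableSet (Prod.fst ⁻¹' (F : Set X)ᶜ : Set (X × JA A)) :=
    measurable_fst (.of_discrete)
  have h2 : ∫⁻ q, G.p q.1 q.2 ((F₀ ∪ F.biUnion F₁ : Finset X) : Set X)ᶜ ∂(ρ : Measure (X × JA A)) ≤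
      (ρ : Measure (X × JA A)) (Prod.fst ⁻¹' (F : Set X)ᶜ) + ε := by
    calc _ ≤ ∫⁻ q, ((Prod.fst ⁻¹' (F : Set X)ᶜ).indicator 1 q + ε) ∂(ρ : Measure (X × JA A)) := by
          refine lintegral_mono_ae ?_
          filter_upwards [bal_ae G ρ hρ] with q hq
          by_cases hqF : q.1 ∈ F
          · refine le_trans ?_ le_add_self
            refine (measure_mono ?_).trans (hF₁ q.1 q.2 hq)
            rw [Set.compl_subset_compl, Finset.coe_subset]
            exact (Finset.subset_biUnion_of_mem F₁ hqF).trans Finset.subset_union_right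
          · refine le_trans prob_le_one ?_
            have : q ∈ (Prod.fst ⁻¹' (F : Set X)ᶜ : Set (X × JA A)) := hqF
            rw [Set.indicator_of_mem this]
            exact le_self_add
      _ = _ := by
          rw [lintegral_add_right _ measurable_const, lintegral_indicator_one hmF]
          simp
  calc _ ≤ ENNReal.ofReal (1 - G.α) * ε + ENNReal.ofReal G.α *
        ((ρ : Measure (X × JA A)) (Prod.fst ⁻¹' (F : Set X)ᶜ) + ε) := by gcongr
    _ = ENNReal.ofReal G.α * (ρ : Measure (X × JA A)) (Prod.fst ⁻¹' (F : Set X)ᶜ) +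
        (ENNReal.ofReal (1 - G.α) + ENNReal.ofReal G.α) * ε := by ring
    _ = _ := by
      rw [← ENNReal.ofReal_add (by linarith [G.hα1]) G.hα0.le]
      simp

theorem tight_states (hA1 : AssumptionA1 G) {ε : ℝ≥0∞} (hε : 0 < ε) :
    ∃ F : Finset X, ∀ ρ : ProbabilityMeasure (X × JA A), Bal G ρ →
      (ρ : Measure (X × JA A)) (Prod.fst ⁻¹' (F : Set X)ᶜ) ≤ ε := by
  set g : Finset X → ℝ≥0∞ := fun F => ⨆ (ρ : ProbabilityMeasure (X × JA A)) (_ : Bal G ρ),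
    (ρ : Measure (X × JA A)) (Prod.fst ⁻¹' (F : Set X)ᶜ) with hg
  have hg1 : ∀ F, g F ≤ 1 := fun F => iSup₂_le fun ρ _ => prob_le_one
  set s := ⨅ F, g F with hs
  have hα : ENNReal.ofReal G.α < 1 := by simpa using G.hα1
  have h1 : ∀ F, s ≤ ENNReal.ofReal G.α * g F := by
    intro F
    refine ENNReal.le_of_forall_pos_le_add fun δ hδ _ => ?_
    obtain ⟨F', hF'⟩ := tight_step G hA1 F (ε := δ) (by simpa using hδ)
    refine (iInf_le _ F').trans (iSup₂_le fun ρ hρ => (hF' ρ hρ).trans ?_)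
    gcongr
    exact le_iSup₂ (f := fun (ρ : ProbabilityMeasure (X × JA A)) (_ : Bal G ρ) =>
      (ρ : Measure (X × JA A)) (Prod.fst ⁻¹' (F : Set X)ᶜ)) ρ hρ
  have hs1 : s ≤ 1 := (iInf_le _ ∅).trans (hg1 _)
  have h2 : s ≤ ENNReal.ofReal G.α * s := by
    conv_rhs => rw [hs, ENNReal.mul_iInf_of_ne (by simpa using G.hα0) ENNReal.ofReal_ne_top]
    exact le_iInf h1
  have hs0 : s = 0 := by
    by_contra hne
    have : ENNReal.ofReal G.α * s < 1 * s :=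
      (ENNReal.mul_lt_mul_iff_left hne (hs1.trans_lt ENNReal.one_lt_top).ne).2 hα
    rw [one_mul] at this
    exact absurd h2 (not_le.2 this)
  have h3 : (⨅ F, g F) < ε := by rw [← hs, hs0]; exact hε
  obtain ⟨F, hF⟩ := iInf_lt_iff.1 h3
  exact ⟨F, fun ρ hρ => (le_iSup₂ (f := fun (ρ : ProbabilityMeasure (X × JA A)) (_ : Bal G ρ) =>
      (ρ : Measure (X × JA A)) (Prod.fst ⁻¹' (F : Set X)ᶜ)) ρ hρ).trans hF.le⟩

theorem tight_OccSet (hA1 : AssumptionA1 G) :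
    IsTightMeasureSet {x | ∃ μ ∈ OccSet G, (μ : Measure (X × JA A)) = x} := by
  rw [isTightMeasureSet_iff_exists_isCompact_measure_compl_le]
  intro ε hε
  obtain ⟨F, hF⟩ := tight_states G hA1 hε
  refine ⟨⋃ x ∈ F, {x} ×ˢ jointSet G x, ?_, ?_⟩
  · exact F.isCompact_biUnion fun x _ => isCompact_singleton.prod (isCompact_jointSet G x)
  · rintro _ ⟨ρ, hρ, rfl⟩
    rw [mem_OccSet] at hρ
    refine le_trans ?_ (hF ρ hρ)
    refine measure_mono_ae ?_
    filter_upwards [bal_ae G ρ hρ] with q hq h1 h2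
    refine h1 ?_
    simp only [Set.mem_iUnion]
    exact ⟨q.1, h2, rfl, hq⟩

theorem exists_bcf (hA1 : AssumptionA1 G) (y : X) :
    ∃ g : BoundedContinuousFunction (X × JA A) ℝ≥0, ∀ q ∈ KSet G, (g q : ℝ≥0∞) = G.p q.1 q.2 {y} := by
  have := G.hp
  have hc : ContinuousOn (fun q : X × JA A => (G.p q.1 q.2 {y}).toReal) (KSet G) := by
    rintro ⟨x, a⟩ hq
    have h1 : ContinuousWithinAt (fun b => (G.p x b {y}).toReal) (jointSet G x) a :=
      (ENNReal.tendsto_toReal (measure_ne_top _ _)).comp (hA1 x y a hq)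
    have h2 : ContinuousWithinAt (fun q : X × JA A => (G.p x q.2 {y}).toReal)
        (Prod.fst ⁻¹' {x} ∩ KSet G) (x, a) := by
      refine ContinuousWithinAt.comp (t := jointSet G x) (g := fun b => (G.p x b {y}).toReal)
        (f := Prod.snd) h1 continuous_snd.continuousWithinAt ?_
      rintro ⟨x', a'⟩ ⟨h3, h4⟩
      obtain rfl : x' = x := h3
      exact h4
    have h3 : Prod.fst ⁻¹' {x} ∈ 𝓝 ((x, a) : X × JA A) :=
      ((isOpen_discrete _).preimage continuous_fst).mem_nhds rfl
    have h4 : ContinuousWithinAt (fun q : X × JA A => (G.p q.1 q.2 {y}).toReal)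
        (Prod.fst ⁻¹' {x} ∩ KSet G) (x, a) := by
      refine h2.congr ?_ rfl
      rintro ⟨x', a'⟩ ⟨h3, h4⟩
      obtain rfl : x' = x := h3
      rfl
    exact (continuousWithinAt_inter' (mem_nhdsWithin_of_mem_nhds h3)).1 (by rwa [Set.inter_comm])
  let f : BoundedContinuousFunction (KSet G) ℝ :=
    BoundedContinuousFunction.ofNormedAddCommGroup
      (fun q : KSet G => (G.p q.1.1 q.1.2 {y}).toReal) (continuousOn_iff_continuous_domRestrict.1 hc) 1
      (by
        intro q
        rw [Real.norm_of_nonneg ENNReal.toReal_nonneg]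
        exact ENNReal.toReal_le_of_le_ofReal zero_le_one (by simpa using prob_le_one))
  letI := TopologicalSpace.metrizableSpaceMetric (X × JA A)
  obtain ⟨g, -, hg⟩ := f.exists_extension_norm_eq_of_isClosedEmbedding
    (isClosed_KSet G).isClosedEmbedding_subtypeVal
  refine ⟨g.nnrealPart, fun q hq => ?_⟩
  have h1 : g q = (G.p q.1 q.2 {y}).toReal := congrFun hg ⟨q, hq⟩
  change ((g q).toNNReal : ℝ≥0∞) = _
  rw [h1]
  exact ENNReal.ofReal_toReal (measure_ne_top _ _)

theorem isClosed_OccSet (hA1 : AssumptionA1 G) : IsClosed (OccSet G) := by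
  letI := TopologicalSpace.metrizableSpaceMetric (X × JA A)
  choose g hg using exists_bcf G hA1
  have hy : ∀ y : X, ∃ f : BoundedContinuousFunction (X × JA A) ℝ≥0,
      ∀ q, (f q : ℝ≥0∞) = ({y} : Set X).indicator 1 q.1 := by
    intro y
    refine ⟨(BoundedContinuousFunction.indicator ({y} : Set X) (isClopen_discrete _)).nnrealPart.compContinuous
      ⟨Prod.fst, continuous_fst⟩, fun q => ?_⟩
    by_cases h : q.1 = y <;> simp [h]
  choose f hf using hy
  have e : OccSet G = {ρ : ProbabilityMeasure (X × JA A) | (ρ : Measure (X × JA A)) (KSet G)ᶜ = 0} ∩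
      ⋂ y, {ρ : ProbabilityMeasure (X × JA A) | ∫⁻ q, f y q ∂(ρ : Measure (X × JA A)) =
        ENNReal.ofReal (1 - G.α) * G.η {y} +
          ENNReal.ofReal G.α * ∫⁻ q, g y q ∂(ρ : Measure (X × JA A))} := by
    ext ρ
    rw [mem_OccSet, Bal]
    simp only [Set.mem_inter_iff, Set.mem_iInter, Set.mem_ofPred_eq]
    refine and_congr_right fun h0 => forall_congr' fun y => ?_
    rw [lintegral_fst_indicator]
    simp only [hf]
    have : ∫⁻ q, g y q ∂(ρ : Measure (X × JA A)) = ∫⁻ q, G.p q.1 q.2 {y} ∂(ρ : Measure (X × JA A)) := by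
      refine lintegral_congr_ae ?_
      have h0' : ∀ᵐ q ∂(ρ : Measure (X × JA A)), q ∈ KSet G := h0
      filter_upwards [h0'] with q hq
      exact hg y q hq
    rw [this]
  rw [e]
  refine IsClosed.inter ?_ (isClosed_iInter fun y => isClosed_eq ?_ ?_)
  · refine isClosed_of_closure_subset fun ρ hρ => ?_
    have hne := mem_closure_iff_nhdsWithin_neBot.1 hρ
    set S := {ρ : ProbabilityMeasure (X × JA A) | (ρ : Measure (X × JA A)) (KSet G)ᶜ = 0}
    have ht : Tendsto id (𝓝[S] ρ) (𝓝 ρ) := tendsto_id.mono_left nhdsWithin_le_nhds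
    have := ProbabilityMeasure.le_liminf_measure_open_of_tendsto ht (isClosed_KSet G).isOpen_compl
    have h2 : liminf (fun i : ProbabilityMeasure (X × JA A) =>
        ((id i : ProbabilityMeasure (X × JA A)) : Measure (X × JA A)) (KSet G)ᶜ) (𝓝[S] ρ) = 0 := by
      have hev : ∀ᶠ μ in 𝓝[S] ρ, ((id μ : ProbabilityMeasure (X × JA A)) : Measure (X × JA A))
          (KSet G)ᶜ = 0 := eventually_nhdsWithin_of_forall fun μ hμ => hμ
      exact (liminf_congr hev).trans (liminf_const _)
    rw [h2] at this
    exact le_antisymm this zero_le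
  · exact ProbabilityMeasure.continuous_lintegral_boundedContinuousFunction _
  · refine continuous_const.add ?_
    exact (ENNReal.continuous_const_mul ENNReal.ofReal_ne_top).comp
      (ProbabilityMeasure.continuous_lintegral_boundedContinuousFunction _)

theorem isCompact_OccSet (hA1 : AssumptionA1 G) : IsCompact (OccSet G) := by
  have := isCompact_closure_of_isTightMeasureSet (tight_OccSet G hA1)
  rwa [(isClosed_OccSet G hA1).closure_eq] at this

theorem continuous_projAct (i : Fin n) : Continuous (projAct i : X × JA A → X × A i) := by
  unfold projAct
  fun_prop

theorem MiSet_eq (i : Fin n) : MiSet G i =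
    (fun ρ : ProbabilityMeasure (X × JA A) =>
      ρ.map (continuous_projAct (X := X) (A := A) i).measurable.aemeasurable) '' OccSet G := by
  ext μ
  constructor
  · rintro ⟨ρ, hρ, h⟩
    exact ⟨ρ, hρ, Subtype.ext h.symm⟩
  · rintro ⟨ρ, hρ, rfl⟩
    exact ⟨ρ, hρ, rfl⟩

theorem Bal.convex {ρ₁ ρ₂ : Measure (X × JA A)} (h₁ : Bal G ρ₁) (h₂ : Bal G ρ₂) {s t : ℝ≥0∞}
    (hst : s + t = 1) : Bal G (s • ρ₁ + t • ρ₂) := by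
  refine ⟨by simp [h₁.1, h₂.1], fun y => ?_⟩
  rw [lintegral_add_measure, lintegral_smul_measure, lintegral_smul_measure]
  simp only [Measure.add_apply, Measure.smul_apply, smul_eq_mul, h₁.2 y, h₂.2 y]
  calc _ = (s + t) * (ENNReal.ofReal (1 - G.α) * G.η {y}) + ENNReal.ofReal G.α *
        (s * ∫⁻ q, G.p q.1 q.2 {y} ∂ρ₁ + t * ∫⁻ q, G.p q.1 q.2 {y} ∂ρ₂) := by ring
    _ = _ := by rw [hst, one_mul]

/-- Lemma 2. -/
theorem stmt5 (hA1 : AssumptionA1 G) (i : Fin n) :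
    (∀ μ₁ ∈ MiSet G i, ∀ μ₂ ∈ MiSet G i, ∀ θ : ℝ, 0 ≤ θ → θ ≤ 1 →
      ∃ μ ∈ MiSet G i, (μ : Measure (X × A i)) =
        ENNReal.ofReal θ • (μ₁ : Measure (X × A i)) +
          ENNReal.ofReal (1 - θ) • (μ₂ : Measure (X × A i))) ∧
    IsCompact (MiSet G i) := by
  constructor
  · rintro μ₁ ⟨ρ₁, h₁, e₁⟩ μ₂ ⟨ρ₂, h₂, e₂⟩ θ h0 h1
    rw [mem_OccSet] at h₁ h₂
    have hst : ENNReal.ofReal θ + ENNReal.ofReal (1 - θ) = 1 := by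
      rw [← ENNReal.ofReal_add h0 (by linarith)]
      simp
    have hm : Measurable (projAct i : X × JA A → X × A i) := (continuous_projAct i).measurable
    let ρ : ProbabilityMeasure (X × JA A) :=
      ⟨ENNReal.ofReal θ • (ρ₁ : Measure (X × JA A)) +
        ENNReal.ofReal (1 - θ) • (ρ₂ : Measure (X × JA A)), ⟨by simp [hst]⟩⟩
    have hρ : ρ ∈ OccSet G := (mem_OccSet G ρ).2 (Bal.convex G h₁ h₂ hst)
    refine ⟨ρ.map hm.aemeasurable, ⟨ρ, hρ, rfl⟩, ?_⟩
    rw [e₁, e₂, ← Measure.map_smul, ← Measure.map_smul, ← Measure.map_add _ _ hm]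
    rfl
  · rw [MiSet_eq]
    exact (isCompact_OccSet G hA1).image
      (ProbabilityMeasure.continuous_map (continuous_projAct i))


end CSGame
end

section
/- Assume A, C and that all functions c_i^ℓ (i ∈ N, ℓ ∈ L_0) are bounded. Then for every stationary multi-strategy φ ∈ Φ and every player i ∈ N, the constrained optimisation problem COP(φ_{-i}) has a solution, and its solution set O_i(φ_{-i}) is nonempty, convex and compact in the weak topology of Pr(K_i). -/
open MeasureTheory ProbabilityTheory Filter Topology
open scoped ENNReal NNReal

open CSGame

namespace CSGame

variable {n l : ℕ}
variable {X : Type} [Countable X] [MeasurableSpace X] [DiscreteMeasurableSpace X]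
  [TopologicalSpace X] [DiscreteTopology X] [BorelSpace X] [SecondCountableTopology X]
variable {A : Fin n → Type} [∀ i, MeasurableSpace (A i)] [∀ i, TopologicalSpace (A i)]
  [∀ i, PolishSpace (A i)] [∀ i, BorelSpace (A i)]
variable (G : GameData n l X A)

set_option linter.unusedSectionVars false

/-- Product law of all players in state `x`. -/
noncomputable def prodLaw (φ : StatProfile G) (x : X) : Measure (JA A) :=
  Measure.pi fun j => ((φ j).1 x : Measure (A j))

instance (φ : StatProfile G) (x : X) : IsProbabilityMeasure (prodLaw G φ x) := by
  unfold prodLaw; infer_instance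

lemma statJoint_eq_map (φ : StatProfile G) (i : Fin n) (x : X) (ai : A i) :
    statJoint G φ i x ai = (prodLaw G φ x).map (fun a => Function.update a i ai) := by
  unfold statJoint prodLaw
  set f : (j : Fin n) → A j → A j := fun j b =>
    if h : j = i then cast (congrArg A h.symm) ai else b with hf
  have h1 : (fun a : JA A => Function.update a i ai) = fun a j => f j (a j) := by
    funext a j
    by_cases h : j = i
    · subst h; simp [hf]
    · simp [hf, h]
  have hfm : ∀ j, Measurable (f j) := by
    intro j
    by_cases h : j = i
    · subst h; simp [hf]
    · simp only [hf, h, dite_false]; exact measurable_id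
  have : ∀ j, IsProbabilityMeasure (((φ j).1 x : Measure (A j)).map (f j)) := fun j =>
    Measure.isProbabilityMeasure_map (hfm j).aemeasurable
  rw [h1, Measure.pi_map_pi (fun j => (hfm j).aemeasurable)]
  congr 1
  funext j
  by_cases h : j = i
  · subst h
    simp [hf, Measure.map_const]
  · have : f j = id := by funext b; simp [hf, h]
    simp [this, h]

lemma measurable_upd (i : Fin n) :
    Measurable (fun q : A i × JA A => Function.update q.2 i q.1) := by
  refine measurable_pi_lambda _ fun j => ?_
  by_cases h : j = i
  · subst h; simpa using measurable_fst
  · simp only [Function.update, h, dite_false]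
    exact (measurable_pi_apply j).comp measurable_snd

lemma measurable_upd' (i : Fin n) (ai : A i) :
    Measurable (fun a : JA A => Function.update a i ai) :=
  (measurable_upd i).comp measurable_prodMk_left

instance statJoint_prob (φ : StatProfile G) (i : Fin n) (x : X) (ai : A i) :
    IsProbabilityMeasure (statJoint G φ i x ai) := by
  rw [statJoint_eq_map]
  exact Measure.isProbabilityMeasure_map (measurable_upd' i ai).aemeasurable

lemma measurable_statJoint (φ : StatProfile G) (i : Fin n) (x : X) :
    Measurable (statJoint G φ i x) := by
  refine Measure.measurable_of_measurable_coe _ fun s hs => ?_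
  have : (fun b => statJoint G φ i x b s) = fun b =>
      prodLaw G φ x (Prod.mk b ⁻¹' ((fun q : A i × JA A => Function.update q.2 i q.1) ⁻¹' s)) := by
    funext b
    rw [statJoint_eq_map, Measure.map_apply (measurable_upd' i b) hs]
    rfl
  rw [this]
  exact measurable_measure_prodMk_left (measurable_upd i hs)

/-- Averaged function. -/
noncomputable def gbar (φ : StatProfile G) (i : Fin n) (g : X → JA A → ℝ) (q : X × A i) : ℝ :=
  ∫ a, g q.1 a ∂(statJoint G φ i q.1 q.2)

lemma gbar_eq (φ : StatProfile G) (i : Fin n) (g : X → JA A → ℝ) (hg : ∀ x, Measurable (g x))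
    (q : X × A i) :
    gbar G φ i g q = ∫ a, g q.1 (Function.update a i q.2) ∂(prodLaw G φ q.1) := by
  unfold gbar
  rw [statJoint_eq_map, integral_map (measurable_upd' i q.2).aemeasurable
    (hg q.1).aestronglyMeasurable]

lemma gbar_meas (φ : StatProfile G) (i : Fin n) (g : X → JA A → ℝ) (hg : ∀ x, Measurable (g x)) :
    Measurable (gbar G φ i g) := by
  refine measurable_from_prod_countable_right fun x => ?_
  have : (fun b => gbar G φ i g (x, b)) = fun b =>
      ∫ a, (fun q : A i × JA A => g x (Function.update q.2 i q.1)) (b, a) ∂(prodLaw G φ x) := by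
    funext b; rw [gbar_eq G φ i g hg]
  rw [this]
  exact (((hg x).comp (measurable_upd i)).stronglyMeasurable.integral_prod_right').measurable

lemma gbar_bdd (φ : StatProfile G) (i : Fin n) (g : X → JA A → ℝ) {C : ℝ}
    (hC : ∀ x a, |g x a| ≤ C) (q : X × A i) : |gbar G φ i g q| ≤ C := by
  unfold gbar
  have := norm_integral_le_of_norm_le_const (μ := statJoint G φ i q.1 q.2) (f := g q.1) (C := C)
    (ae_of_all _ fun a => hC _ a)
  simpa using this

lemma prodLaw_ae (φ : StatProfile G) (x : X) :
    ∀ᵐ a ∂(prodLaw G φ x), a ∈ jointSet G x := by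
  unfold prodLaw jointSet
  have h : ∀ j, ∀ᵐ a ∂(Measure.pi fun j => ((φ j).1 x : Measure (A j))), a j ∈ G.As j x := by
    intro j
    refine (Measure.quasiMeasurePreserving_eval _ j).ae ?_
    have h2 := (φ j).2 x
    have h3 : ((φ j).1 x : Measure (A j)) (G.As j x) = 1 := by
      rw [← ProbabilityMeasure.ennreal_coeFn_eq_coeFn_toMeasure, h2]; rfl
    exact (mem_ae_iff_prob_eq_one (G.hAs_cpt j x).isClosed.measurableSet).2 h3
  filter_upwards [ae_all_iff.2 h] with a ha
  intro j _
  exact ha j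

lemma gbar_cont (φ : StatProfile G) (i : Fin n) (g : X → JA A → ℝ) (hg : ∀ x, Measurable (g x))
    {C : ℝ} (hC : ∀ x a, |g x a| ≤ C) (hcont : ∀ x, ContinuousOn (g x) (jointSet G x)) (x : X) :
    ContinuousOn (fun b => gbar G φ i g (x, b)) (G.As i x) := by
  have : (fun b => gbar G φ i g (x, b)) = fun b =>
      ∫ a, g x (Function.update a i b) ∂(prodLaw G φ x) := by
    funext b; rw [gbar_eq G φ i g hg]
  rw [this]
  refine continuousOn_of_dominated (bound := fun _ => C) ?_ ?_ (integrable_const C) ?_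
  · intro b _
    exact ((hg x).comp (measurable_upd' i b)).aestronglyMeasurable
  · intro b _
    exact ae_of_all _ fun a => hC _ _
  · filter_upwards [prodLaw_ae G φ x] with a ha
    refine (hcont x).comp ?_ ?_
    · exact (continuous_const.update i continuous_id).continuousOn
    · intro b hb j _
      by_cases h : j = i
      · subst h; simpa using hb
      · simpa [h] using ha j trivial

/-- The graph `𝕂_i`. -/
def KK (i : Fin n) : Set (X × A i) := {q | q.2 ∈ G.As i q.1}

lemma KK_closed (i : Fin n) : IsClosed (KK G i) := by
  have : KK G i = ⋂ x : X, ((({x}ᶜ : Set X) ×ˢ Set.univ) ∪ (Set.univ ×ˢ G.As i x)) := by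
    ext q
    simp only [KK, Set.mem_ofPred_eq, Set.mem_iInter, Set.mem_union, Set.mem_prod,
      Set.mem_compl_iff, Set.mem_singleton_iff, Set.mem_univ, and_true, true_and]
    constructor
    · intro h x
      by_cases hx : q.1 = x
      · right; exact hx ▸ h
      · left; exact hx
    · intro h
      exact (h q.1).resolve_left (by simp)
  rw [this]
  refine isClosed_iInter fun x => ?_
  exact ((isClosed_discrete _).prod isClosed_univ).union
    (isClosed_univ.prod (G.hAs_cpt i x).isClosed)

lemma exists_ext (i : Fin n) (f : X × A i → ℝ) {C : ℝ} (hC : ∀ q, |f q| ≤ C)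
    (hf : ∀ x, ContinuousOn (fun b => f (x, b)) (G.As i x)) :
    ∃ F : BoundedContinuousFunction (X × A i) ℝ, ∀ q ∈ KK G i, F q = f q := by
  have hcont : ContinuousOn f (KK G i) := by
    rintro ⟨x, b⟩ hb
    have hU : ({x} ×ˢ Set.univ : Set (X × A i)) ∈ 𝓝 (x, b) :=
      prod_mem_nhds (by simp) univ_mem
    rw [← continuousWithinAt_inter hU]
    have h1 : ContinuousWithinAt (fun q : X × A i => f (x, q.2))
        (KK G i ∩ ({x} ×ˢ Set.univ)) (x, b) := by
      refine ContinuousWithinAt.comp (f := Prod.snd) (g := fun b => f (x, b)) (t := G.As i x)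
        (hf x b hb) continuous_snd.continuousWithinAt ?_
      rintro ⟨y, c⟩ ⟨h1, h2⟩
      simp at h2
      subst h2
      exact h1
    refine h1.congr ?_ rfl
    rintro ⟨y, c⟩ ⟨h1, h2⟩
    simp at h2
    subst h2
    rfl
  let f' : BoundedContinuousFunction (KK G i) ℝ :=
    BoundedContinuousFunction.ofNormedAddCommGroup (fun q => f q.1)
      (continuousOn_iff_continuous_domRestrict.1 hcont) C (fun q => hC _)
  obtain ⟨F, -, hF⟩ := f'.exists_norm_eq_domRestrict_eq_of_closed (KK_closed G i)
  refine ⟨F, fun q hq => ?_⟩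
  have := DFunLike.congr_fun hF ⟨q, hq⟩
  exact this

/-- Real-valued transition probabilities. -/
noncomputable def pr (y : X) (x : X) (a : JA A) : ℝ := (G.p x a {y}).toReal

lemma pr_meas (y x : X) : Measurable (pr G y x) := (G.hpm x y).ennreal_toReal

lemma pr_nonneg (y x : X) (a : JA A) : 0 ≤ pr G y x a := ENNReal.toReal_nonneg

lemma pr_bdd (y x : X) (a : JA A) : |pr G y x a| ≤ 1 := by
  have := G.hp x a
  rw [abs_of_nonneg (pr_nonneg G y x a)]
  exact measureReal_le_one

lemma pr_cont (hA : AssumptionA G) (y x : X) : ContinuousOn (pr G y x) (jointSet G x) := by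
  intro a ha
  have := G.hp x a
  exact (ENNReal.tendsto_toReal (measure_ne_top (G.p x a) {y})).comp (hA.1 x y a ha)

lemma pbar_eq (φ : StatProfile G) (i : Fin n) (y : X) (q : X × A i) :
    pbar G φ i y q.1 q.2 = ENNReal.ofReal (gbar G φ i (pr G y) q) := by
  unfold pbar gbar
  rw [ofReal_integral_eq_lintegral_ofReal]
  · refine lintegral_congr fun a => ?_
    have := G.hp q.1 a
    rw [pr, ENNReal.ofReal_toReal (measure_ne_top _ _)]
  · exact Integrable.of_bound (pr_meas G y q.1).aestronglyMeasurable 1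
      (ae_of_all _ fun a => pr_bdd G y q.1 a)
  · exact ae_of_all _ fun a => pr_nonneg G y q.1 a

lemma gpr_nonneg (φ : StatProfile G) (i : Fin n) (y : X) (q : X × A i) :
    0 ≤ gbar G φ i (pr G y) q := integral_nonneg fun a => pr_nonneg G y q.1 a

lemma integrable_gbar (φ : StatProfile G) (i : Fin n) (g : X → JA A → ℝ)
    (hg : ∀ x, Measurable (g x)) {C : ℝ} (hC : ∀ x a, |g x a| ≤ C)
    (μ : Measure (X × A i)) [IsFiniteMeasure μ] : Integrable (gbar G φ i g) μ :=
  Integrable.of_bound (gbar_meas G φ i g hg).aestronglyMeasurable C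
    (ae_of_all _ fun q => gbar_bdd G φ i g hC q)

lemma lint_pbar (φ : StatProfile G) (i : Fin n) (y : X) (μ : Measure (X × A i))
    [IsFiniteMeasure μ] :
    ∫⁻ q : X × A i, pbar G φ i y q.1 q.2 ∂μ = ENNReal.ofReal (∫ q, gbar G φ i (pr G y) q ∂μ) := by
  rw [ofReal_integral_eq_lintegral_ofReal]
  · exact lintegral_congr fun q => pbar_eq G φ i y q
  · exact integrable_gbar G φ i _ (pr_meas G y) (pr_bdd G y) μ
  · exact ae_of_all _ fun q => gpr_nonneg G φ i y q

lemma ae_KK (i : Fin n) (μ : Measure (X × A i)) [IsProbabilityMeasure μ]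
    (h : μ (KK G i) = 1) : ∀ᵐ q ∂μ, q ∈ KK G i :=
  (mem_ae_iff_prob_eq_one (KK_closed G i).measurableSet).2 h

lemma KK_slice (i : Fin n) (μ : Measure (X × A i)) [IsProbabilityMeasure μ]
    (h : μ (KK G i) = 1) (x : X) : μ ({x} ×ˢ G.As i x) = μ ({x} ×ˢ Set.univ) := by
  refine measure_congr ?_
  filter_upwards [ae_KK G i μ h] with q hq
  apply propext
  change (q ∈ ({x} ×ˢ G.As i x : Set (X × A i))) ↔ q ∈ ({x} ×ˢ Set.univ : Set (X × A i))
  simp only [Set.mem_prod, Set.mem_singleton_iff, Set.mem_univ, and_true, and_iff_left_iff_imp]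
  intro hx
  exact hx ▸ hq

lemma feas_iff (φ : StatProfile G) (i : Fin n) (μ : ProbabilityMeasure (X × A i)) :
    COPFeasible G φ i μ ↔ (μ : Measure (X × A i)) (KK G i) = 1 ∧
      (∀ ℓ : Fin (l + 1), ℓ ≠ 0 → ∫ q, gbar G φ i (G.c i ℓ) q ∂(μ : Measure (X × A i)) ≤ G.κ i ℓ) ∧
      ∀ x : X, (μ : Measure (X × A i)).real ({x} ×ˢ Set.univ) =
        (1 - G.α) * G.η.real {x} +
          G.α * ∫ q, gbar G φ i (pr G x) q ∂(μ : Measure (X × A i)) := by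
  unfold COPFeasible
  have := G.hη
  have h0 := G.hα0
  have h1 := G.hα1
  refine and_congr_right fun hK => and_congr Iff.rfl (forall_congr' fun x => ?_)
  have hK' : (μ : Measure (X × A i)) (KK G i) = 1 := hK
  rw [KK_slice G i _ hK' x, lint_pbar]
  have hn : 0 ≤ ∫ q, gbar G φ i (pr G x) q ∂(μ : Measure (X × A i)) :=
    integral_nonneg fun q => gpr_nonneg G φ i x q
  have e : ENNReal.ofReal (1 - G.α) * G.η {x} +
      ENNReal.ofReal G.α * ENNReal.ofReal (∫ q, gbar G φ i (pr G x) q ∂(μ : Measure (X × A i)))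
      = ENNReal.ofReal ((1 - G.α) * G.η.real {x} +
          G.α * ∫ q, gbar G φ i (pr G x) q ∂(μ : Measure (X × A i))) := by
    rw [ENNReal.ofReal_add (by have : 0 ≤ 1 - G.α := by linarith
                               positivity) (by positivity),
      ENNReal.ofReal_mul (by linarith), ENNReal.ofReal_mul h0.le, ofReal_measureReal]
  rw [e, ← ofReal_measureReal, ENNReal.ofReal_eq_ofReal_iff measureReal_nonneg]
  have : 0 ≤ 1 - G.α := by linarith
  positivity

lemma closed_KK (i : Fin n) :
    IsClosed {μ : ProbabilityMeasure (X × A i) | (μ : Measure (X × A i)) (KK G i) = 1} := by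
  let := TopologicalSpace.upgradeIsCompletelyMetrizable (X × A i)
  rw [isClosed_iff_clusterPt]
  intro μ hμ
  have hne : (𝓝 μ ⊓ 𝓟 {μ : ProbabilityMeasure (X × A i) |
    (μ : Measure (X × A i)) (KK G i) = 1}).NeBot := hμ
  have h1 := ProbabilityMeasure.limsup_measure_closed_le_of_tendsto
    (L := 𝓝 μ ⊓ 𝓟 {μ : ProbabilityMeasure (X × A i) | (μ : Measure (X × A i)) (KK G i) = 1})
    (μs := id) (μ := μ) (tendsto_id.mono_left inf_le_left) (KK_closed G i)
  have h2 : (fun ν : ProbabilityMeasure (X × A i) => ((id ν : ProbabilityMeasure (X × A i)) : Measure (X × A i)) (KK G i))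
      =ᶠ[𝓝 μ ⊓ 𝓟 {μ : ProbabilityMeasure (X × A i) |
        (μ : Measure (X × A i)) (KK G i) = 1}] fun _ => 1 := by
    filter_upwards [mem_inf_of_right (mem_principal_self _)] with ν hν
    exact hν
  rw [limsup_congr h2, limsup_const] at h1
  exact le_antisymm prob_le_one h1

/-- Extension of an averaged function. -/
lemma exists_gext (φ : StatProfile G) (i : Fin n) (g : X → JA A → ℝ)
    (hg : ∀ x, Measurable (g x)) (hC : ∃ C : ℝ, ∀ x a, |g x a| ≤ C)
    (hcont : ∀ x, ContinuousOn (g x) (jointSet G x)) :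
    ∃ F : BoundedContinuousFunction (X × A i) ℝ,
      ∀ μ : ProbabilityMeasure (X × A i), (μ : Measure (X × A i)) (KK G i) = 1 →
      ∫ q, gbar G φ i g q ∂(μ : Measure (X × A i)) = ∫ q, F q ∂(μ : Measure (X × A i)) := by
  obtain ⟨C, hC⟩ := hC
  obtain ⟨F, hF⟩ := exists_ext G i (gbar G φ i g) (gbar_bdd G φ i g hC)
    (gbar_cont G φ i g hg hC hcont)
  refine ⟨F, fun μ hμ => integral_congr_ae ?_⟩
  filter_upwards [ae_KK G i _ hμ] with q hq
  exact (hF q hq).symm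

lemma closed_feas (hA : AssumptionA G) (hb : BoundedCosts G) (φ : StatProfile G) (i : Fin n) :
    IsClosed {μ | COPFeasible G φ i μ} := by
  have hc := fun ℓ => exists_gext G φ i (G.c i ℓ) (G.hc i ℓ) (hb i ℓ) (hA.2 i ℓ)
  choose F hF using hc
  have hp := fun y => exists_gext G φ i (pr G y) (pr_meas G y) ⟨1, pr_bdd G y⟩ (pr_cont G hA y)
  choose P hP using hp
  have hI := fun x : X => exists_ext G i
    (Set.indicator ({x} ×ˢ Set.univ : Set (X × A i)) (fun _ => (1 : ℝ))) (C := 1)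
    (by intro q; by_cases h : q ∈ ({x} ×ˢ Set.univ : Set (X × A i)) <;> simp [Set.indicator, h])
    (by
      intro y
      refine Continuous.continuousOn ?_
      have : (fun b : A i => Set.indicator ({x} ×ˢ Set.univ : Set (X × A i)) (fun _ => (1 : ℝ)) (y, b))
        = fun _ => Set.indicator {x} (fun _ => (1 : ℝ)) y := by
        funext b; by_cases h : y = x <;> simp [Set.indicator, Set.mem_prod, h]
      rw [this]; exact continuous_const)
  choose I hI using hI
  have : {μ | COPFeasible G φ i μ} =
      {μ : ProbabilityMeasure (X × A i) | (μ : Measure (X × A i)) (KK G i) = 1} ∩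
      ((⋂ ℓ : Fin (l + 1), ⋂ _ : ℓ ≠ 0,
        {μ | ∫ q, F ℓ q ∂(μ : Measure (X × A i)) ≤ G.κ i ℓ}) ∩
      ⋂ x : X, {μ | ∫ q, I x q ∂(μ : Measure (X × A i)) =
        (1 - G.α) * G.η.real {x} + G.α * ∫ q, P x q ∂(μ : Measure (X × A i))}) := by
    ext μ
    simp only [Set.mem_ofPred_eq, Set.mem_inter_iff, Set.mem_iInter, feas_iff]
    refine and_congr_right fun hK => and_congr ?_ (forall_congr' fun x => ?_)
    · exact forall_congr' fun ℓ => forall_congr' fun _ => by rw [hF ℓ μ hK]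
    · rw [hP x μ hK]
      have : ∫ q, I x q ∂(μ : Measure (X × A i)) =
          (μ : Measure (X × A i)).real ({x} ×ˢ Set.univ) := by
        rw [← integral_indicator_one ((measurableSet_singleton x).prod MeasurableSet.univ)]
        refine integral_congr_ae ?_
        filter_upwards [ae_KK G i _ hK] with q hq
        rw [hI x q hq]; rfl
      rw [this]
  rw [this]
  have hcI : ∀ f : BoundedContinuousFunction (X × A i) ℝ, Continuous
      fun μ : ProbabilityMeasure (X × A i) => ∫ q, f q ∂(μ : Measure (X × A i)) := fun f =>
    ProbabilityMeasure.continuous_integral_boundedContinuousFunction f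
  refine (closed_KK G i).inter (IsClosed.inter ?_ ?_)
  · exact isClosed_iInter fun ℓ => isClosed_iInter fun _ => isClosed_le (hcI _) continuous_const
  · exact isClosed_iInter fun x => isClosed_eq (hcI _) (by have := hcI (P x); fun_prop)

lemma tsum_sing (m : Measure X) [IsProbabilityMeasure m] : ∑' y, m {y} = 1 := by
  have h := lintegral_countable' (μ := m) (fun _ : X => (1 : ℝ≥0∞))
  simp only [lintegral_const, measure_univ, one_mul] at h
  exact h.symm

lemma hasSum_sing (m : Measure X) [IsProbabilityMeasure m] : HasSum (fun y => m.real {y}) 1 := by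
  have h := ENNReal.hasSum_toReal (f := fun y => m {y}) (by rw [tsum_sing]; simp)
  rwa [← ENNReal.tsum_toReal_eq (fun y => measure_ne_top _ _), tsum_sing, ENNReal.toReal_one] at h

lemma tsum_pbar (φ : StatProfile G) (i : Fin n) (q : X × A i) :
    ∑' y, pbar G φ i y q.1 q.2 = 1 := by
  unfold pbar
  rw [← lintegral_tsum fun y => (G.hpm q.1 y).aemeasurable]
  have : ∀ a, ∑' y, G.p q.1 a {y} = 1 := fun a => by
    have := G.hp q.1 a
    exact tsum_sing _
  simp [this]

lemma hasSum_gpr (φ : StatProfile G) (i : Fin n) (q : X × A i) :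
    HasSum (fun y => gbar G φ i (pr G y) q) 1 := by
  have h1 := tsum_pbar G φ i q
  have h2 : ∀ y, (pbar G φ i y q.1 q.2).toReal = gbar G φ i (pr G y) q := fun y => by
    rw [pbar_eq, ENNReal.toReal_ofReal (gpr_nonneg G φ i y q)]
  have h := ENNReal.hasSum_toReal (f := fun y => pbar G φ i y q.1 q.2) (by rw [h1]; simp)
  rw [← ENNReal.tsum_toReal_eq (fun y => by rw [pbar_eq]; simp), h1, ENNReal.toReal_one] at h
  simpa only [h2] using h

lemma dini (hA : AssumptionA G) (φ : StatProfile G) (i : Fin n) (x : X) {ε : ℝ} (hε : 0 < ε) :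
    ∃ F : Finset X, ∀ b ∈ G.As i x, 1 - ε < ∑ y ∈ F, gbar G φ i (pr G y) (x, b) := by
  classical
  refine (G.hAs_cpt i x).induction_on
    (p := fun s => ∃ F : Finset X, ∀ b ∈ s, 1 - ε < ∑ y ∈ F, gbar G φ i (pr G y) (x, b)) ?_ ?_ ?_ ?_
  · exact ⟨∅, by simp⟩
  · rintro s t hst ⟨F, hF⟩
    exact ⟨F, fun b hb => hF b (hst hb)⟩
  · rintro s t ⟨F, hF⟩ ⟨F', hF'⟩
    refine ⟨F ∪ F', ?_⟩
    rintro b (hb | hb)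
    · exact (hF b hb).trans_le (Finset.sum_le_sum_of_subset_of_nonneg Finset.subset_union_left
        fun y _ _ => gpr_nonneg G φ i y _)
    · exact (hF' b hb).trans_le (Finset.sum_le_sum_of_subset_of_nonneg Finset.subset_union_right
        fun y _ _ => gpr_nonneg G φ i y _)
  · intro b hb
    have h1 := (hasSum_gpr G φ i (x, b))
    obtain ⟨F, hF⟩ := (h1.eventually (lt_mem_nhds (show 1 - ε < 1 by linarith))).exists
    have hc : ContinuousOn (fun b => ∑ y ∈ F, gbar G φ i (pr G y) (x, b)) (G.As i x) :=
      continuousOn_finsetSum _ fun y _ =>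
        gbar_cont G φ i (pr G y) (pr_meas G y) (pr_bdd G y) (pr_cont G hA y) x
    exact ⟨_, (hc b hb).eventually (lt_mem_nhds hF), F, fun c hc => hc⟩

/-- Marginal masses of finite sets. -/
lemma real_fin (i : Fin n) (μ : Measure (X × A i)) [IsProbabilityMeasure μ] (F : Finset X) :
    μ.real ((F : Set X) ×ˢ Set.univ) = ∑ x ∈ F, μ.real ({x} ×ˢ Set.univ) := by
  have : ((F : Set X) ×ˢ Set.univ : Set (X × A i)) = ⋃ x ∈ F, ({x} ×ˢ Set.univ) := by
    ext q; simp
  rw [this, measureReal_biUnion_finset]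
  · intro x _ y _ hxy
    refine Set.disjoint_left.2 ?_
    rintro q ⟨h1, _⟩ ⟨h2, _⟩
    exact hxy (h1.symm.trans h2)
  · exact fun x _ => (measurableSet_singleton x).prod MeasurableSet.univ

lemma step (φ : StatProfile G) (i : Fin n) {ε : ℝ} (hε1 : ε ≤ 1) (F F' : Finset X)
    (hη : 1 - ε ≤ ∑ x ∈ F', G.η.real {x})
    (hF : ∀ x ∈ F, ∀ b ∈ G.As i x, 1 - ε ≤ ∑ y ∈ F', gbar G φ i (pr G y) (x, b))
    (μ : ProbabilityMeasure (X × A i)) (hμ : COPFeasible G φ i μ) :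
    1 - (μ : Measure (X × A i)).real ((F' : Set X) ×ˢ Set.univ) ≤
      ε + G.α * (1 - (μ : Measure (X × A i)).real ((F : Set X) ×ˢ Set.univ)) := by
  obtain ⟨hK, -, hx⟩ := (feas_iff G φ i μ).1 hμ
  have h0 := G.hα0
  have h1 := G.hα1
  set m := (μ : Measure (X × A i)).real ((F : Set X) ×ˢ Set.univ) with hm
  have hm1 : m ≤ 1 := measureReal_le_one
  have hm0 : 0 ≤ m := measureReal_nonneg
  have hint : ∀ y ∈ F', Integrable (gbar G φ i (pr G y)) (μ : Measure (X × A i)) := fun y _ =>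
    integrable_gbar G φ i _ (pr_meas G y) (pr_bdd G y) _
  have e1 : (μ : Measure (X × A i)).real ((F' : Set X) ×ˢ Set.univ) =
      (1 - G.α) * ∑ x ∈ F', G.η.real {x} +
        G.α * ∫ q, ∑ y ∈ F', gbar G φ i (pr G y) q ∂(μ : Measure (X × A i)) := by
    rw [real_fin, Finset.sum_congr rfl fun x _ => hx x, Finset.sum_add_distrib, ← Finset.mul_sum,
      ← Finset.mul_sum, integral_finsetSum _ hint]
  have e2 : (1 - ε) * m ≤ ∫ q, ∑ y ∈ F', gbar G φ i (pr G y) q ∂(μ : Measure (X × A i)) := by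
    have hS : MeasurableSet ((F : Set X) ×ˢ Set.univ : Set (X × A i)) :=
      (F.measurableSet).prod MeasurableSet.univ
    have : (1 - ε) * m = ∫ q, Set.indicator ((F : Set X) ×ˢ Set.univ : Set (X × A i))
        (fun _ => 1 - ε) q ∂(μ : Measure (X × A i)) := by
      rw [integral_indicator_const _ hS, smul_eq_mul, mul_comm]
    rw [this]
    refine integral_mono_ae ((integrable_const _).indicator hS) (integrable_finsetSum _ hint) ?_
    filter_upwards [ae_KK G i _ hK] with q hq
    by_cases hqF : q ∈ ((F : Set X) ×ˢ Set.univ : Set (X × A i))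
    · rw [Set.indicator_of_mem hqF]
      exact hF q.1 (by simpa using hqF.1) q.2 hq
    · rw [Set.indicator_of_notMem hqF]
      exact Finset.sum_nonneg fun y _ => gpr_nonneg G φ i y q
  rw [e1]
  have a1 := mul_le_mul_of_nonneg_left e2 h0.le
  have a2 := mul_le_mul_of_nonneg_left hη (show 0 ≤ 1 - G.α by linarith)
  have a3 : G.α * (ε * m) ≤ G.α * ε := by
    by_cases hε : 0 ≤ ε
    · exact mul_le_mul_of_nonneg_left (mul_le_of_le_one_right hε hm1) h0.le
    · exfalso
      have : ∑ x ∈ F', G.η.real {x} ≤ 1 := by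
        have := G.hη
        exact sum_le_hasSum F' (fun x _ => measureReal_nonneg) (hasSum_sing G.η)
      linarith
  nlinarith

lemma exists_next (hA : AssumptionA G) (φ : StatProfile G) (i : Fin n) {ε : ℝ} (hε : 0 < ε)
    (F : Finset X) : ∃ F' : Finset X, 1 - ε ≤ ∑ x ∈ F', G.η.real {x} ∧
      ∀ x ∈ F, ∀ b ∈ G.As i x, 1 - ε ≤ ∑ y ∈ F', gbar G φ i (pr G y) (x, b) := by
  classical
  have := G.hη
  obtain ⟨F0, hF0⟩ := ((hasSum_sing G.η).eventually
    (lt_mem_nhds (show 1 - ε < 1 by linarith))).exists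
  choose D hD using fun x => dini G hA φ i x hε
  refine ⟨F0 ∪ F.biUnion D, ?_, ?_⟩
  · exact hF0.le.trans (Finset.sum_le_sum_of_subset_of_nonneg Finset.subset_union_left
        fun y _ _ => measureReal_nonneg)
  · intro x hx b hb
    refine (hD x b hb).le.trans (Finset.sum_le_sum_of_subset_of_nonneg ?_
      fun y _ _ => gpr_nonneg G φ i y _)
    exact (Finset.subset_biUnion_of_mem D hx).trans Finset.subset_union_right

lemma exists_fin (hA : AssumptionA G) (φ : StatProfile G) (i : Fin n) {δ : ℝ} (hδ : 0 < δ) :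
    ∃ F : Finset X, ∀ μ : ProbabilityMeasure (X × A i), COPFeasible G φ i μ →
      1 - (μ : Measure (X × A i)).real ((F : Set X) ×ˢ Set.univ) ≤ δ := by
  have h0 := G.hα0
  have h1 := G.hα1
  set ε := min 1 (δ / 2 * (1 - G.α)) with hεd
  have hε : 0 < ε := lt_min one_pos (by have : 0 < 1 - G.α := by linarith
                                        positivity)
  have key : ∀ k : ℕ, ∃ F : Finset X, ∀ μ : ProbabilityMeasure (X × A i), COPFeasible G φ i μ →
      1 - (μ : Measure (X × A i)).real ((F : Set X) ×ˢ Set.univ) ≤ G.α ^ k + δ / 2 := by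
    intro k
    induction k with
    | zero =>
      refine ⟨∅, fun μ _ => ?_⟩
      simp
      linarith
    | succ k ih =>
      obtain ⟨F, hF⟩ := ih
      obtain ⟨F', h1', h2'⟩ := exists_next G hA φ i hε F
      refine ⟨F', fun μ hμ => ?_⟩
      have := step G φ i (min_le_left _ _) F F' h1' h2' μ hμ
      have h3 := mul_le_mul_of_nonneg_left (hF μ hμ) h0.le
      have h4 : ε ≤ δ / 2 * (1 - G.α) := min_le_right _ _
      rw [pow_succ]
      nlinarith
  obtain ⟨k, hk⟩ := exists_pow_lt_of_lt_one (half_pos hδ) h1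
  obtain ⟨F, hF⟩ := key k
  exact ⟨F, fun μ hμ => (hF μ hμ).trans (by linarith)⟩

lemma compact_feas (hA : AssumptionA G) (hb : BoundedCosts G) (φ : StatProfile G) (i : Fin n) :
    IsCompact {μ | COPFeasible G φ i μ} := by
  rw [← (closed_feas G hA hb φ i).closure_eq]
  apply isCompact_closure_of_isTightMeasureSet
  rw [isTightMeasureSet_iff_exists_isCompact_measure_compl_le]
  intro δ hδ
  obtain ⟨δ', hδ', hle⟩ : ∃ δ' : ℝ, 0 < δ' ∧ ENNReal.ofReal δ' ≤ δ := by
    by_cases h : δ = ⊤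
    · exact ⟨1, one_pos, by simp [h]⟩
    · exact ⟨δ.toReal, ENNReal.toReal_pos hδ.ne' h, ENNReal.ofReal_toReal_le⟩
  obtain ⟨F, hF⟩ := exists_fin G hA φ i hδ'
  refine ⟨⋃ x ∈ F, {x} ×ˢ G.As i x, ?_, ?_⟩
  · exact F.isCompact_biUnion fun x _ => isCompact_singleton.prod (G.hAs_cpt i x)
  · rintro _ ⟨μ, hμ, rfl⟩
    refine le_trans ?_ hle
    have hK := ((feas_iff G φ i μ).1 hμ).1
    have hS : MeasurableSet ((F : Set X) ×ˢ Set.univ : Set (X × A i)) :=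
      (F.measurableSet).prod MeasurableSet.univ
    have h2 : (μ : Measure (X × A i)) (⋃ x ∈ F, {x} ×ˢ G.As i x)ᶜ ≤
        (μ : Measure (X × A i)) ((F : Set X) ×ˢ Set.univ)ᶜ := by
      refine measure_mono_ae ?_
      filter_upwards [ae_KK G i _ hK] with q hq h3 h4
      apply h3
      simp only [Set.mem_iUnion]
      exact ⟨q.1, by simpa using h4.1, rfl, hq⟩
    refine h2.trans ?_
    rw [← ofReal_measureReal]
    refine ENNReal.ofReal_le_ofReal ?_
    rw [probReal_compl_eq_one_sub hS]
    exact hF μ hμ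

section Generic

variable {Ω B Y : Type} [MeasurableSpace Ω] [MeasurableSpace B] [MeasurableSpace Y]

lemma meas_map_mk (J : Ω → Measure B) (hJ : Measurable J) [∀ h, IsProbabilityMeasure (J h)] :
    Measurable (fun h => (J h).map (fun b => (h, b))) := by
  let κ : Kernel Ω B := ⟨J, hJ⟩
  have : IsMarkovKernel κ := ⟨fun h => inferInstanceAs (IsProbabilityMeasure (J h))⟩
  refine Measure.measurable_of_measurable_coe _ fun s hs => ?_
  have : (fun h => (J h).map (fun b => (h, b)) s) = fun h => κ h (Prod.mk h ⁻¹' s) := by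
    funext h
    rw [Measure.map_apply measurable_prodMk_left hs]
    rfl
  rw [this]
  exact Kernel.measurable_kernel_prodMk_left hs

lemma meas_map_last (J : Ω → Measure B) (hJ : Measurable J) [∀ h, IsProbabilityMeasure (J h)]
    (f : Ω → Y) (hf : Measurable f) :
    Measurable (fun h => (J h).map (fun b => (f h, b))) := by
  have h1 := meas_map_mk J hJ
  have hm : Measurable (fun q : Ω × B => (f q.1, q.2)) :=
    (hf.comp measurable_fst).prodMk measurable_snd
  have h2 := (Measure.measurable_map _ hm).comp h1
  refine (congrArg Measurable ?_).mp h2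
  funext h
  simp only [Function.comp]
  rw [Measure.map_map hm measurable_prodMk_left]
  rfl

lemma inner_eq (J : Ω → Measure B) (P : Ω × B → Measure Y) (hP : Measurable P)
    [∀ q, IsProbabilityMeasure (P q)] (h : Ω) :
    ((J h).bind fun a => (P (h, a)).map fun y => (h, a, y)) =
      (((J h).map (fun b => (h, b))).bind fun q => (P q).map fun y => (q, y)).map
        (fun z : (Ω × B) × Y => (z.1.1, z.1.2, z.2)) := by
  have hm : Measurable (fun z : (Ω × B) × Y => (z.1.1, z.1.2, z.2)) := by fun_prop
  have h2 := meas_map_mk P hP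
  have h1 : Measurable (fun a : B => (P (h, a)).map fun y => (h, a, y)) := by
    have := (Measure.measurable_map _ hm).comp (h2.comp (measurable_prodMk_left (x := h)))
    refine (congrArg Measurable ?_).mp this
    funext a
    simp only [Function.comp]
    rw [Measure.map_map hm measurable_prodMk_left]
    rfl
  ext s hs
  rw [Measure.bind_apply hs h1.aemeasurable, Measure.map_apply hm hs,
    Measure.bind_apply (hm hs) h2.aemeasurable]
  refine Eq.trans ?_
    (lintegral_map ((Measure.measurable_coe (hm hs)).comp h2) measurable_prodMk_left).symm
  refine lintegral_congr fun a => ?_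
  simp only [Function.comp]
  rw [Measure.map_apply (by fun_prop) hs, Measure.map_apply measurable_prodMk_left (hm hs)]
  rfl

lemma meas_inner (J : Ω → Measure B) (hJ : Measurable J) [∀ h, IsProbabilityMeasure (J h)]
    (P : Ω × B → Measure Y) (hP : Measurable P) [∀ q, IsProbabilityMeasure (P q)] :
    Measurable (fun h => (J h).bind fun a => (P (h, a)).map fun y => (h, a, y)) := by
  simp_rw [inner_eq J P hP]
  have hm : Measurable (fun z : (Ω × B) × Y => (z.1.1, z.1.2, z.2)) := by fun_prop
  exact (Measure.measurable_map _ hm).comp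
    ((Measure.measurable_bind' (meas_map_mk P hP)).comp (meas_map_mk J hJ))

lemma prob_inner (J : Ω → Measure B) [∀ h, IsProbabilityMeasure (J h)]
    (P : Ω × B → Measure Y) (hP : Measurable P) [∀ q, IsProbabilityMeasure (P q)] (h : Ω) :
    IsProbabilityMeasure ((J h).bind fun a => (P (h, a)).map fun y => (h, a, y)) := by
  rw [inner_eq J P hP]
  have : IsProbabilityMeasure ((J h).map (fun b => (h, b))) :=
    Measure.isProbabilityMeasure_map measurable_prodMk_left.aemeasurable
  have := isProbabilityMeasure_bind (m := (J h).map (fun b => (h, b)))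
    (meas_map_mk P hP).aemeasurable
    (ae_of_all _ fun q => Measure.isProbabilityMeasure_map measurable_prodMk_left.aemeasurable)
  exact Measure.isProbabilityMeasure_map (by fun_prop)

lemma inner_snd (J : Ω → Measure B) 
    (P : Ω × B → Measure Y) (hP : Measurable P) [∀ q, IsProbabilityMeasure (P q)] (h : Ω)
    (s : Set Y) (hs : MeasurableSet s) :
    ((J h).bind fun a => (P (h, a)).map fun y => (h, a, y)) {z | z.2.2 ∈ s} =
      ∫⁻ a, P (h, a) s ∂(J h) := by
  have hS : MeasurableSet {z : Ω × B × Y | z.2.2 ∈ s} :=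
    (measurable_snd.comp measurable_snd) hs
  have hm : Measurable (fun z : (Ω × B) × Y => (z.1.1, z.1.2, z.2)) := by fun_prop
  have h2 := meas_map_mk P hP
  rw [inner_eq J P hP, Measure.map_apply hm hS, Measure.bind_apply (hm hS) h2.aemeasurable]
  refine (lintegral_map ((Measure.measurable_coe (hm hS)).comp h2) measurable_prodMk_left).trans ?_
  refine lintegral_congr fun a => ?_
  simp only [Function.comp]
  rw [Measure.map_apply measurable_prodMk_left (hm hS)]
  rfl

lemma integral_bind' (m : Measure Ω) [IsProbabilityMeasure m] (κ : Ω → Measure B)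
    (hκ : Measurable κ) [∀ h, IsProbabilityMeasure (κ h)] (f : B → ℝ) (hf : Measurable f) {C : ℝ}
    (hC : ∀ b, |f b| ≤ C) : ∫ b, f b ∂(m.bind κ) = ∫ h, ∫ b, f b ∂(κ h) ∂m := by
  let κ' : Kernel Ω B := ⟨κ, hκ⟩
  have e : m.bind κ = (κ' ∘ₖ Kernel.const Unit m) () := by
    rw [Kernel.comp_apply, Kernel.const_apply]; rfl
  have : IsProbabilityMeasure (m.bind κ) := isProbabilityMeasure_bind hκ.aemeasurable
    (ae_of_all _ fun h => inferInstance)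
  have hi : Integrable f (m.bind κ) := Integrable.of_bound hf.aestronglyMeasurable C (ae_of_all _ hC)
  rw [e] at hi ⊢
  rw [Kernel.integral_comp hi, Kernel.const_apply]
  rfl

end Generic

lemma meas_p : Measurable (fun q : X × JA A => G.p q.1 q.2) := by
  refine measurable_from_prod_countable_right fun x => ?_
  refine Measure.measurable_of_measurable_coe _ fun s hs => ?_
  have : (fun a => G.p x a s) = fun a => ∑' y, s.indicator (fun y => G.p x a {y}) y := by
    funext a; rw [Measure.tsum_indicator_apply_singleton _ s hs]
  simp only [this]
  refine Measurable.tsum fun y => ?_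
  by_cases h : y ∈ s
  · simpa [h] using G.hpm x y
  · simp [h]

instance (π : MultiStrategy G) (t : ℕ) (h : Hist X (JA A) t) :
    IsProbabilityMeasure (jointLaw G π t h) := by
  unfold jointLaw; infer_instance

lemma meas_jointLaw (π : MultiStrategy G) (t : ℕ) : Measurable (jointLaw G π t) := by
  refine Measurable.measure_of_isPiSystem_of_isProbabilityMeasure generateFrom_pi.symm
    isPiSystem_pi ?_
  rintro _ ⟨s, hs, rfl⟩
  simp only [jointLaw, Measure.pi_pi]
  exact Finset.measurable_prod _ fun j _ => (π j).meas t (s j) (hs j trivial)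

lemma meas_strat {i : Fin n} (σ : Strategy G i) (t : ℕ) :
    Measurable (fun h => (σ.f t h : Measure (A i))) :=
  Measure.measurable_of_measurable_coe _ fun s hs => σ.meas t s hs

lemma jointLaw_combine (φ : StatProfile G) (i : Fin n) (σ : Strategy G i) (t : ℕ)
    (h : Hist X (JA A) t) :
    jointLaw G (combine G (ofStatAll G φ) i σ) t h =
      (σ.f t h : Measure (A i)).bind (statJoint G φ i (lastState X (JA A) t h)) := by
  refine Measure.pi_eq fun s hs => ?_
  rw [Measure.bind_apply (MeasurableSet.univ_pi hs) (measurable_statJoint G φ i _).aemeasurable]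
  have key : ∀ b : A i, statJoint G φ i (lastState X (JA A) t h) b (Set.univ.pi s) =
      (s i).indicator 1 b * ∏ j ∈ Finset.univ.erase i,
        ((φ j).1 (lastState X (JA A) t h) : Measure (A j)) (s j) := by
    intro b
    unfold statJoint
    have : ∀ j, SigmaFinite (if h' : j = i then Measure.dirac (cast (congrArg A h'.symm) b)
      else ((φ j).1 (lastState X (JA A) t h) : Measure (A j))) := by
      intro j
      by_cases h' : j = i
      · simp only [h', dite_true]; infer_instance
      · simp only [h', dite_false]; infer_instance
    rw [Measure.pi_pi, ← Finset.mul_prod_erase Finset.univ _ (Finset.mem_univ i)]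
    congr 1
    · simp [Measure.dirac_apply' _ (hs i)]
    · refine Finset.prod_congr rfl fun j hj => ?_
      rw [dif_neg (Finset.ne_of_mem_erase hj)]
  simp_rw [key]
  rw [lintegral_mul_const _ (measurable_one.indicator (hs i)), lintegral_indicator_one (hs i),
    ← Finset.mul_prod_erase Finset.univ _ (Finset.mem_univ i)]
  congr 1
  · simp [combine]
  · refine Finset.prod_congr rfl fun j hj => ?_
    rw [combine, Function.update_of_ne (Finset.ne_of_mem_erase hj)]
    rfl

lemma meas_trans (t : ℕ) :
    Measurable (fun q : Hist X (JA A) t × JA A => G.p (lastState X (JA A) t q.1) q.2) :=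
  (meas_p G).comp (((measurable_lastState X (JA A) t).comp measurable_fst).prodMk measurable_snd)

instance hist_prob (π : MultiStrategy G) (t : ℕ) : IsProbabilityMeasure (histMeas G G.η π t) := by
  induction t with
  | zero => exact G.hη
  | succ t ih =>
    have hp : ∀ q : Hist X (JA A) t × JA A,
      IsProbabilityMeasure (G.p (lastState X (JA A) t q.1) q.2) := fun q => G.hp _ _
    exact isProbabilityMeasure_bind
      (meas_inner (jointLaw G π t) (meas_jointLaw G π t) _ (meas_trans G t)).aemeasurable
      (ae_of_all _ fun h => prob_inner (jointLaw G π t) _ (meas_trans G t) h)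

lemma hist_succ (π : MultiStrategy G) (t : ℕ) (y : X) :
    histMeas G G.η π (t + 1) (lastState X (JA A) (t + 1) ⁻¹' {y}) =
      ∫⁻ h, ∫⁻ a, G.p (lastState X (JA A) t h) a {y} ∂(jointLaw G π t h) ∂(histMeas G G.η π t) := by
  have hp : ∀ q : Hist X (JA A) t × JA A,
      IsProbabilityMeasure (G.p (lastState X (JA A) t q.1) q.2) := fun q => G.hp _ _
  have h1 := Measure.bind_apply (m := histMeas G G.η π t)
    (s := {z : Hist X (JA A) t × JA A × X | z.2.2 ∈ ({y} : Set X)})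
    ((measurable_snd.comp measurable_snd) (measurableSet_singleton y))
    (meas_inner (jointLaw G π t) (meas_jointLaw G π t) _ (meas_trans G t)).aemeasurable
  refine Eq.trans h1 (lintegral_congr fun h => ?_)
  exact inner_snd (jointLaw G π t) _ (meas_trans G t) h {y} (measurableSet_singleton y)

/-- Stage `t` law of (state, action of player `i`). -/
noncomputable def nu (φ : StatProfile G) (i : Fin n) (σ : Strategy G i) (t : ℕ) :
    Measure (X × A i) :=
  (histMeas G G.η (combine G (ofStatAll G φ) i σ) t).bind fun h =>
    (σ.f t h : Measure (A i)).map fun b => (lastState X (JA A) t h, b)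

lemma meas_nuk {i : Fin n} (σ : Strategy G i) (t : ℕ) :
    Measurable fun h => (σ.f t h : Measure (A i)).map fun b => (lastState X (JA A) t h, b) :=
  meas_map_last _ (meas_strat G σ t) _ (measurable_lastState X (JA A) t)

instance nuk_prob {i : Fin n} (σ : Strategy G i) (t : ℕ) (h : Hist X (JA A) t) :
    IsProbabilityMeasure
      ((σ.f t h : Measure (A i)).map fun b => (lastState X (JA A) t h, b)) :=
  Measure.isProbabilityMeasure_map measurable_prodMk_left.aemeasurable

instance nu_prob (φ : StatProfile G) (i : Fin n) (σ : Strategy G i) (t : ℕ) :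
    IsProbabilityMeasure (nu G φ i σ t) :=
  isProbabilityMeasure_bind (meas_nuk G σ t).aemeasurable (ae_of_all _ fun h => inferInstance)

lemma nu_apply (φ : StatProfile G) (i : Fin n) (σ : Strategy G i) (t : ℕ) (s : Set (X × A i))
    (hs : MeasurableSet s) : nu G φ i σ t s =
      ∫⁻ h, (σ.f t h : Measure (A i)) {b | (lastState X (JA A) t h, b) ∈ s}
        ∂(histMeas G G.η (combine G (ofStatAll G φ) i σ) t) := by
  unfold nu
  rw [Measure.bind_apply hs (meas_nuk G σ t).aemeasurable]
  refine lintegral_congr fun h => ?_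
  rw [Measure.map_apply measurable_prodMk_left hs]
  rfl

lemma nu_lint (φ : StatProfile G) (i : Fin n) (σ : Strategy G i) (t : ℕ) (f : X × A i → ℝ≥0∞)
    (hf : Measurable f) : ∫⁻ q, f q ∂(nu G φ i σ t) =
      ∫⁻ h, ∫⁻ b, f (lastState X (JA A) t h, b) ∂(σ.f t h : Measure (A i))
        ∂(histMeas G G.η (combine G (ofStatAll G φ) i σ) t) := by
  unfold nu
  rw [Measure.lintegral_bind (meas_nuk G σ t).aemeasurable hf.aemeasurable]
  refine lintegral_congr fun h => ?_
  rw [lintegral_map hf measurable_prodMk_left]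

lemma nu_KK (φ : StatProfile G) (i : Fin n) (σ : Strategy G i) (t : ℕ) :
    nu G φ i σ t (KK G i) = 1 := by
  rw [nu_apply G φ i σ t _ (KK_closed G i).measurableSet]
  have : ∀ h, (σ.f t h : Measure (A i)) {b | (lastState X (JA A) t h, b) ∈ KK G i} = 1 := by
    intro h
    have h2 := σ.supp t h
    change (σ.f t h : Measure (A i)) (G.As i (lastState X (JA A) t h)) = 1
    rw [← ProbabilityMeasure.ennreal_coeFn_eq_coeFn_toMeasure, h2]; rfl
  simp [this]

lemma nu_slice (φ : StatProfile G) (i : Fin n) (σ : Strategy G i) (t : ℕ) (x : X) :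
    nu G φ i σ t ({x} ×ˢ Set.univ) =
      histMeas G G.η (combine G (ofStatAll G φ) i σ) t (lastState X (JA A) t ⁻¹' {x}) := by
  classical
  rw [nu_apply G φ i σ t _ ((measurableSet_singleton x).prod MeasurableSet.univ)]
  rw [← lintegral_indicator_one (measurable_lastState X (JA A) t (measurableSet_singleton x))]
  refine lintegral_congr fun h => ?_
  by_cases hx : lastState X (JA A) t h = x
  · simp [Set.indicator, hx]
  · simp [Set.indicator, hx]

lemma meas_pbar (φ : StatProfile G) (i : Fin n) (y : X) :
    Measurable fun q : X × A i => pbar G φ i y q.1 q.2 := by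
  simp_rw [pbar_eq]
  exact (gbar_meas G φ i _ (pr_meas G y)).ennreal_ofReal

lemma nu_zero (φ : StatProfile G) (i : Fin n) (σ : Strategy G i) (x : X) :
    nu G φ i σ 0 ({x} ×ˢ Set.univ) = G.η {x} := by
  rw [nu_slice]; rfl

lemma nu_succ (φ : StatProfile G) (i : Fin n) (σ : Strategy G i) (t : ℕ) (y : X) :
    nu G φ i σ (t + 1) ({y} ×ˢ Set.univ) =
      ∫⁻ q : X × A i, pbar G φ i y q.1 q.2 ∂(nu G φ i σ t) := by
  rw [nu_slice, hist_succ, nu_lint G φ i σ t _ (meas_pbar G φ i y)]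
  refine lintegral_congr fun h => ?_
  rw [jointLaw_combine, Measure.lintegral_bind (measurable_statJoint G φ i _).aemeasurable
    (G.hpm _ y).aemeasurable]
  rfl

lemma nu_int (φ : StatProfile G) (i : Fin n) (σ : Strategy G i) (t : ℕ) (g : X → JA A → ℝ)
    (hg : ∀ x, Measurable (g x)) {C : ℝ} (hC : ∀ x a, |g x a| ≤ C) :
    stageExp G G.η (combine G (ofStatAll G φ) i σ) t g =
      ∫ q, gbar G φ i g q ∂(nu G φ i σ t) := by
  unfold stageExp nu
  rw [integral_bind' _ _ (meas_nuk G σ t) _ (gbar_meas G φ i g hg) (gbar_bdd G φ i g hC)]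
  refine integral_congr_ae (ae_of_all _ fun h => ?_)
  simp only
  rw [integral_map measurable_prodMk_left.aemeasurable
    (gbar_meas G φ i g hg).aestronglyMeasurable, jointLaw_combine,
    integral_bind' _ _ (measurable_statJoint G φ i _) _ (hg _) (hC _)]
  rfl

/-- Occupation measure of player `i`. -/
noncomputable def occi (φ : StatProfile G) (i : Fin n) (σ : Strategy G i) : Measure (X × A i) :=
  ENNReal.ofReal (1 - G.α) • Measure.sum fun t : ℕ => ENNReal.ofReal G.α ^ t • nu G φ i σ t

lemma occi_apply (φ : StatProfile G) (i : Fin n) (σ : Strategy G i) (s : Set (X × A i))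
    (hs : MeasurableSet s) : occi G φ i σ s =
      ENNReal.ofReal (1 - G.α) * ∑' t : ℕ, ENNReal.ofReal G.α ^ t * nu G φ i σ t s := by
  simp [occi, Measure.sum_apply _ hs]

lemma geom_one : ENNReal.ofReal (1 - G.α) * ∑' t : ℕ, ENNReal.ofReal G.α ^ t = 1 := by
  have h0 := G.hα0
  have h1 := G.hα1
  rw [ENNReal.tsum_geometric, ENNReal.ofReal_sub _ h0.le, ENNReal.ofReal_one]
  refine ENNReal.mul_inv_cancel ?_ (by finiteness)
  rw [Ne, tsub_eq_zero_iff_le, not_le]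
  simpa using h1

instance occi_prob (φ : StatProfile G) (i : Fin n) (σ : Strategy G i) :
    IsProbabilityMeasure (occi G φ i σ) := by
  constructor
  rw [occi_apply _ _ _ _ _ MeasurableSet.univ]
  simp only [measure_univ, mul_one]; exact geom_one G

lemma occi_KK (φ : StatProfile G) (i : Fin n) (σ : Strategy G i) :
    occi G φ i σ (KK G i) = 1 := by
  rw [occi_apply _ _ _ _ _ (KK_closed G i).measurableSet]
  simp only [nu_KK, mul_one]; exact geom_one G

lemma occi_char (φ : StatProfile G) (i : Fin n) (σ : Strategy G i) (x : X) :
    occi G φ i σ ({x} ×ˢ Set.univ) = ENNReal.ofReal (1 - G.α) * G.η {x} +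
      ENNReal.ofReal G.α * ∫⁻ q : X × A i, pbar G φ i x q.1 q.2 ∂(occi G φ i σ) := by
  rw [occi_apply _ _ _ _ _ ((measurableSet_singleton x).prod MeasurableSet.univ),
    tsum_eq_zero_add' ENNReal.summable, mul_add, nu_zero, pow_zero, one_mul]
  congr 1
  unfold occi
  rw [lintegral_smul_measure, lintegral_sum_measure]
  simp_rw [lintegral_smul_measure, nu_succ, smul_eq_mul, pow_succ]
  rw [mul_left_comm, ← ENNReal.tsum_mul_left (a := ENNReal.ofReal G.α)]
  congr 2
  funext t
  ring

lemma occi_int (φ : StatProfile G) (i : Fin n) (σ : Strategy G i) (g : X → JA A → ℝ)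
    (hg : ∀ x, Measurable (g x)) {C : ℝ} (hC : ∀ x a, |g x a| ≤ C) :
    ∫ q, gbar G φ i g q ∂(occi G φ i σ) =
      Jfun G G.η g (combine G (ofStatAll G φ) i σ) := by
  have h0 := G.hα0
  have h1 := G.hα1
  have hf : IsFiniteMeasure
      (Measure.sum fun t : ℕ => ENNReal.ofReal G.α ^ t • nu G φ i σ t) := by
    constructor
    rw [Measure.sum_apply _ MeasurableSet.univ]
    simp only [Measure.smul_apply, measure_univ, smul_eq_mul, mul_one]
    rw [lt_top_iff_ne_top]
    intro h
    have := geom_one G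
    rw [h, ENNReal.mul_top (by simpa using h1)] at this
    simp at this
  unfold Jfun
  simp_rw [nu_int G φ i σ _ g hg hC]
  unfold occi
  rw [integral_smul_measure, integral_sum_measure (integrable_gbar G φ i g hg hC _),
    ENNReal.toReal_ofReal (by linarith), smul_eq_mul]
  congr 2
  funext t
  rw [integral_smul_measure, ENNReal.toReal_pow, ENNReal.toReal_ofReal h0.le, smul_eq_mul]

lemma feas_nonempty (hC : AssumptionC G) (hb : BoundedCosts G) (φ : StatProfile G) (i : Fin n) :
    ∃ μ, COPFeasible G φ i μ := by
  obtain ⟨σ, hσ⟩ := hC φ i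
  refine ⟨⟨occi G φ i σ, inferInstance⟩, occi_KK G φ i σ, fun ℓ hℓ => ?_, fun x => ?_⟩
  · obtain ⟨C, hbC⟩ := hb i ℓ
    have h := occi_int G φ i σ (G.c i ℓ) (G.hc i ℓ) (hbC)
    exact h.le.trans (hσ ℓ hℓ).le
  · have := occi_char G φ i σ x
    rw [← KK_slice G i _ (occi_KK G φ i σ) x] at this
    exact this

/-- The convex combination of two probability measures. -/
noncomputable def mix (i : Fin n) (μ ν : ProbabilityMeasure (X × A i)) (θ : ℝ) (h0 : 0 ≤ θ)
    (h1 : θ ≤ 1) : ProbabilityMeasure (X × A i) :=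
  ⟨ENNReal.ofReal θ • (μ : Measure (X × A i)) + ENNReal.ofReal (1 - θ) • (ν : Measure (X × A i)), by
    constructor
    simp only [Measure.add_apply, Measure.smul_apply, measure_univ, smul_eq_mul, mul_one]
    rw [← ENNReal.ofReal_add h0 (by linarith)]
    simp⟩

lemma mix_int (i : Fin n) (μ ν : ProbabilityMeasure (X × A i)) (θ : ℝ) (h0 : 0 ≤ θ)
    (h1 : θ ≤ 1) (φ : StatProfile G) (g : X → JA A → ℝ)
    (hg : ∀ x, Measurable (g x)) {C : ℝ} (hC : ∀ x a, |g x a| ≤ C) :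
    ∫ q, gbar G φ i g q ∂(mix i μ ν θ h0 h1 : Measure (X × A i)) =
      θ * ∫ q, gbar G φ i g q ∂(μ : Measure (X × A i)) +
      (1 - θ) * ∫ q, gbar G φ i g q ∂(ν : Measure (X × A i)) := by
  change ∫ q, gbar G φ i g q ∂(ENNReal.ofReal θ • (μ : Measure (X × A i)) +
    ENNReal.ofReal (1 - θ) • (ν : Measure (X × A i))) = _
  rw [integral_add_measure
    ((integrable_gbar G φ i g hg hC _).smul_measure ENNReal.ofReal_ne_top)
    ((integrable_gbar G φ i g hg hC _).smul_measure ENNReal.ofReal_ne_top),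
    integral_smul_measure, integral_smul_measure, ENNReal.toReal_ofReal h0,
    ENNReal.toReal_ofReal (by linarith), smul_eq_mul, smul_eq_mul]

lemma mix_feas (hb : BoundedCosts G) (φ : StatProfile G) (i : Fin n)
    (μ ν : ProbabilityMeasure (X × A i)) (θ : ℝ) (h0 : 0 ≤ θ)
    (h1 : θ ≤ 1) (hμ : COPFeasible G φ i μ) (hν : COPFeasible G φ i ν) :
    COPFeasible G φ i (mix i μ ν θ h0 h1) := by
  rw [feas_iff] at *
  obtain ⟨a1, a2, a3⟩ := hμ
  obtain ⟨b1, b2, b3⟩ := hν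
  refine ⟨?_, ?_, ?_⟩
  · change ENNReal.ofReal θ * (μ : Measure (X × A i)) (KK G i) +
      ENNReal.ofReal (1 - θ) * (ν : Measure (X × A i)) (KK G i) = 1
    rw [a1, b1, mul_one, mul_one, ← ENNReal.ofReal_add h0 (by linarith)]
    simp
  · intro ℓ hℓ
    obtain ⟨C, hC⟩ := hb i ℓ
    rw [mix_int G i μ ν θ h0 h1 φ _ (G.hc i ℓ) hC]
    have c1 := mul_le_mul_of_nonneg_left (a2 ℓ hℓ) h0
    have c2 := mul_le_mul_of_nonneg_left (b2 ℓ hℓ) (show 0 ≤ 1 - θ by linarith)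
    linarith
  · intro x
    have e : (mix i μ ν θ h0 h1 : Measure (X × A i)).real ({x} ×ˢ Set.univ) =
        θ * (μ : Measure (X × A i)).real ({x} ×ˢ Set.univ) +
        (1 - θ) * (ν : Measure (X × A i)).real ({x} ×ˢ Set.univ) := by
      change (ENNReal.ofReal θ * (μ : Measure (X × A i)) ({x} ×ˢ Set.univ) +
        ENNReal.ofReal (1 - θ) * (ν : Measure (X × A i)) ({x} ×ˢ Set.univ)).toReal = _
      rw [ENNReal.toReal_add (by finiteness) (by finiteness), ENNReal.toReal_mul,
        ENNReal.toReal_mul, ENNReal.toReal_ofReal h0, ENNReal.toReal_ofReal (by linarith)]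
      rfl
    rw [e, a3 x, b3 x, mix_int G i μ ν θ h0 h1 φ _ (pr_meas G x) (pr_bdd G x)]
    ring

/-- Remark 7(b). -/
theorem stmt9 (hA : AssumptionA G) (hC : AssumptionC G) (hb : BoundedCosts G)
    (φ : StatProfile G) (i : Fin n) :
    (COPSol G φ i).Nonempty ∧
    (∀ μ₁ ∈ COPSol G φ i, ∀ μ₂ ∈ COPSol G φ i, ∀ θ : ℝ, 0 ≤ θ → θ ≤ 1 →
      ∃ μ ∈ COPSol G φ i, (μ : Measure (X × A i)) =
        ENNReal.ofReal θ • (μ₁ : Measure (X × A i)) +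
          ENNReal.ofReal (1 - θ) • (μ₂ : Measure (X × A i))) ∧
    IsCompact (COPSol G φ i) := by
  have hcpt := compact_feas G hA hb φ i
  obtain ⟨F, hF⟩ := exists_gext G φ i (G.c i 0) (G.hc i 0) (hb i 0) (hA.2 i 0)
  have hcF : Continuous
      fun μ : ProbabilityMeasure (X × A i) => ∫ q, F q ∂(μ : Measure (X × A i)) :=
    ProbabilityMeasure.continuous_integral_boundedContinuousFunction F
  have hobj : ∀ μ, COPFeasible G φ i μ →
      COPObj G φ i μ = ∫ q, F q ∂(μ : Measure (X × A i)) := fun μ hμ => hF μ hμ.1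
  obtain ⟨μ₀, hμ₀, hmin⟩ := hcpt.exists_isMinOn (feas_nonempty G hC hb φ i) hcF.continuousOn
  have hsol : μ₀ ∈ COPSol G φ i := by
    refine ⟨hμ₀, fun ν hν => ?_⟩
    rw [hobj _ hμ₀, hobj _ hν]
    exact hmin hν
  refine ⟨⟨μ₀, hsol⟩, ?_, ?_⟩
  · intro μ₁ h₁ μ₂ h₂ θ hθ0 hθ1
    refine ⟨mix i μ₁ μ₂ θ hθ0 hθ1, ⟨mix_feas G hb φ i _ _ _ _ _ h₁.1 h₂.1, fun ν hν => ?_⟩, rfl⟩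
    obtain ⟨C, hbC⟩ := hb i 0
    have e : COPObj G φ i (mix i μ₁ μ₂ θ hθ0 hθ1) =
        θ * COPObj G φ i μ₁ + (1 - θ) * COPObj G φ i μ₂ :=
      mix_int G i μ₁ μ₂ θ hθ0 hθ1 φ _ (G.hc i 0) hbC
    rw [e]
    have c1 := mul_le_mul_of_nonneg_left (h₁.2 ν hν) hθ0
    have c2 := mul_le_mul_of_nonneg_left (h₂.2 ν hν) (show 0 ≤ 1 - θ by linarith)
    linarith
  · have : COPSol G φ i = {μ | COPFeasible G φ i μ} ∩
        {μ | ∫ q, F q ∂(μ : Measure (X × A i)) ≤ ∫ q, F q ∂(μ₀ : Measure (X × A i))} := by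
      ext μ
      constructor
      · intro h
        refine ⟨h.1, ?_⟩
        have := h.2 μ₀ hμ₀
        rwa [hobj _ hμ₀, hobj _ h.1] at this
      · rintro ⟨h1, h2⟩
        refine ⟨h1, fun ν hν => ?_⟩
        rw [hobj _ h1, hobj _ hν]
        exact h2.trans (hmin hν)
    rw [this]
    exact hcpt.inter_right (isClosed_le hcF continuous_const)

end CSGame
end
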